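/- arXiv:1908.06156 — 2 statements merged into one kernel-verified Lean document; each statement's English description precedes it below -/
import Mathlib

section
/- Let G be a finite group and p a prime with p ∣ |G| and p² ∤ |G|. Let H, J ≤ G be non-conjugate subgroups such that O^p(H) is conjugate to O^p(J) in G. Then for l ≥ 1, the p-primary part of Ext^l_{A(G)}(ℤ_H, ℤ_H) is 0 when l is odd and isomorphic to ℤ/pℤ when l is even; and the p-primary part of Ext^l_{A(G)}(ℤ_H, ℤ_J) is isomorphic to ℤ/pℤ when l is odd and 0 when l is even. -/
set_option synthInstance.maxHeartbeats 400000
set_option maxHeartbeats 1000000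

noncomputable section

open CategoryTheory

/-- Two subgroups of `G` are conjugate if one is `g H g⁻¹` for some `g ∈ G`. -/
def IsConjSubgroup {G : Type*} [Group G] (H J : Subgroup G) : Prop :=
  ∃ g : G, Subgroup.map (MulAut.conj g).toMonoidHom H = J

/-- The Burnside ring `A(G)` of a finite group `G`, realized via the mark homomorphisms as the
subring of the ghost ring `∏_{H ≤ G} ℤ` generated by the mark vectors `H ↦ |X^H|` of finite
`G`-sets `X`.  (Marks are constant on conjugacy classes of subgroups, so this is the image of
the usual embedding `A(G) → ∏_{(H) ∈ ccs(G)} ℤ`, hence isomorphic to the Burnside ring.) -/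
def burnsideRing (G : Type) [Group G] : Subring ((Subgroup G) → ℤ) :=
  Subring.closure { f | ∃ (X : Type) (_ : Fintype X) (_ : MulAction G X),
    f = fun H : Subgroup G => (Nat.card (MulAction.fixedPoints H X) : ℤ) }

/-- `ℤ_H`: the `A(G)`-module `ℤ` on which `a ∈ A(G)` acts by multiplication by `π_H(a)`,
the `H`-mark of `a`. -/
def ZB (G : Type) [Group G] (H : Subgroup G) : ModuleCat (burnsideRing G) :=
  letI : Module (burnsideRing G) ℤ :=
    Module.compHom ℤ ((Pi.evalRingHom (fun _ => ℤ) H).comp (burnsideRing G).subtype)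
  ModuleCat.of _ ℤ

/-- `O^p(H)`: the smallest normal subgroup `K ⊴ H` with `H/K` a `p`-group, regarded as a
subgroup of `G`. -/
def Op (p : ℕ) {G : Type*} [Group G] (H : Subgroup G) : Subgroup G :=
  (sInf {K : Subgroup H | ∃ _ : K.Normal, IsPGroup p (H ⧸ K)}).map H.subtype

section comparison

variable {R : Type} [CommRing R] {X : ModuleCat.{0} R} (P : ProjectiveResolution X)
  (Y : ModuleCat.{0} R) (n : ℕ)

/-- The part of the complex `Hom(P, Y)` around degree `n + 1`. -/
abbrev homShortComplex : ShortComplex (ModuleCat.{0} R) :=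
  (P.complex.linearYonedaObj R Y).sc' n (n + 1) (n + 2)

/-- The class of a cocycle of `Hom(P, Y)` in `Ext`. -/
def cocycleToExt : LinearMap.ker (homShortComplex P Y n).g.hom →+ Abelian.Ext X Y (n + 1) where
  toFun f := P.extMk (n := n + 1) f.1 (n + 2) rfl f.2
  map_zero' := P.extMk_zero _ _
  map_add' f g := (P.add_extMk f.1 g.1 (n + 2) rfl f.2 g.2).symm

lemma cocycleToExt_eq_zero_iff (f : LinearMap.ker (homShortComplex P Y n).g.hom) :
    cocycleToExt P Y n f = 0 ↔
      f ∈ LinearMap.range (homShortComplex P Y n).moduleCatToCycles := by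
  refine (P.extMk_eq_zero_iff (n := n + 1) f.1 (n + 2) rfl f.2 n rfl).trans ?_
  exact ⟨fun ⟨g, hg⟩ => ⟨g, Subtype.ext hg⟩, fun ⟨g, hg⟩ => ⟨g, congrArg Subtype.val hg⟩⟩

lemma cocycleToExt_surjective : Function.Surjective (cocycleToExt P Y n) := fun x => by
  obtain ⟨f, hf, rfl⟩ := P.extMk_surjective x (n + 2) rfl
  exact ⟨⟨f, hf⟩, rfl⟩

/-- The two definitions of `Ext` groups in positive degrees agree. -/
lemma nonempty_ext_addEquiv_abelianExt (X Y : ModuleCat.{0} R) (n : ℕ) :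
    Nonempty ((((Ext R (ModuleCat.{0} R) (n + 1)).obj (Opposite.op X)).obj Y) ≃+
      Abelian.Ext X Y (n + 1)) := by
  let P := projectiveResolution X
  let S := homShortComplex P Y n
  have e₁ := (P.isoExt (R := R) (n + 1) Y) ≪≫
    ShortComplex.homologyMapIso ((P.complex.linearYonedaObj R Y).isoSc' n (n + 1) (n + 2)
      (by simp) (by simp)) ≪≫ S.moduleCatHomologyIso
  refine ⟨e₁.toLinearEquiv.toAddEquiv.trans ?_⟩
  refine (QuotientAddGroup.quotientAddEquivOfEq ?_).trans
    (QuotientAddGroup.quotientKerEquivOfSurjective _ (cocycleToExt_surjective P Y n))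
  ext f
  exact (cocycleToExt_eq_zero_iff P Y n f).symm

end comparison

section primary

lemma nonempty_primaryComponent_addEquiv {A B : Type*} [AddCommGroup A] [AddCommGroup B]
    {p s : ℕ} (hs : s.Coprime p) (α : A →+ B) (β : B →+ A)
    (hβα : ∀ a, β (α a) = s • a) (hαβ : ∀ b, α (β b) = s • b) :
    Nonempty (AddCommGroup.primaryComponent A p ≃+ AddCommGroup.primaryComponent B p) := by
  have inv : ∀ k, ∃ u v : ℤ, u * s + v * (p ^ k : ℕ) = 1 := fun k => by
    obtain ⟨u, v, h⟩ := Nat.isCoprime_iff_coprime.mpr (hs.pow_right k)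
    exact ⟨u, v, h⟩
  have inj : ∀ {C : Type _} [AddCommGroup C] (c : C) (k : ℕ), p ^ k • c = 0 → s • c = 0 →
      c = 0 := by
    intro C _ c k h₁ h₂
    obtain ⟨u, v, h⟩ := inv k
    calc c = (u * s + v * (p ^ k : ℕ)) • c := by rw [h, one_smul]
      _ = 0 := by rw [add_smul, mul_smul, mul_smul, natCast_zsmul, natCast_zsmul, h₁, h₂]; simp
  have hmem : ∀ a ∈ AddCommGroup.primaryComponent A p,
      α a ∈ AddCommGroup.primaryComponent B p := by
    rintro a ⟨k, hk⟩
    exact ⟨k, by rw [← map_nsmul, hk, map_zero]⟩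
  refine ⟨AddEquiv.ofBijective ((α.comp (AddCommGroup.primaryComponent A p).subtype).codRestrict
    (AddCommGroup.primaryComponent B p) fun a => hmem a a.2) ⟨?_, ?_⟩⟩
  · rw [injective_iff_map_eq_zero]
    rintro ⟨a, k, hk⟩ h
    refine Subtype.ext (inj a k hk ?_)
    rw [← hβα]
    exact (congrArg β (congrArg Subtype.val h)).trans (map_zero β)
  · rintro ⟨b, k, hk⟩
    obtain ⟨u, v, h⟩ := inv k
    refine ⟨⟨u • β b, k, ?_⟩, Subtype.ext ?_⟩
    · rw [smul_comm, ← map_nsmul, hk, map_zero, smul_zero]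
    · change α (u • β b) = b
      rw [map_zsmul, hαβ]
      calc u • s • b = (u * s + v * (p ^ k : ℕ)) • b := by
            rw [add_smul, mul_smul, mul_smul, natCast_zsmul, natCast_zsmul, hk]; simp
        _ = b := by rw [h, one_smul]

lemma primaryComponent_eq_bot_of_addEquiv {A B : Type*} [AddCommGroup A] [AddCommGroup B] {p : ℕ}
    (e : AddCommGroup.primaryComponent A p ≃+ AddCommGroup.primaryComponent B p)
    (h : AddCommGroup.primaryComponent B p = ⊥) : AddCommGroup.primaryComponent A p = ⊥ := by
  rw [AddSubgroup.eq_bot_iff_forall]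
  intro a ha
  have : e ⟨a, ha⟩ = 0 := Subtype.ext ((AddSubgroup.eq_bot_iff_forall _).mp h _ (e ⟨a, ha⟩).2)
  exact congrArg Subtype.val ((map_eq_zero_iff e e.injective).mp this)

lemma nonempty_primaryComponent_addEquiv_zmod {A : Type*} [AddCommGroup A] {p s : ℕ}
    [Fact p.Prime] (hs : s.Coprime p) (e : A) (he : p • e = 0) (he0 : e ≠ 0)
    (hgen : ∀ a : A, ∃ k : ℤ, s • a = k • e) :
    Nonempty (AddCommGroup.primaryComponent A p ≃+ ZMod p) := by
  have heq : AddCommGroup.primaryComponent A p = AddSubgroup.zmultiples e := by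
    apply le_antisymm
    · rintro a ⟨k, hk⟩
      obtain ⟨u, v, h⟩ := Nat.isCoprime_iff_coprime.mpr (hs.pow_right k)
      obtain ⟨c, hc⟩ := hgen a
      refine ⟨u * c, ?_⟩
      change (u * c) • e = a
      calc (u * c) • e = (u * s + v * (p ^ k : ℕ)) • a := by
            rw [add_smul, mul_smul, mul_smul, mul_smul, natCast_zsmul, natCast_zsmul, hk, hc]; simp
        _ = a := by rw [h, one_smul]
    · rw [AddSubgroup.zmultiples_le]
      exact ⟨1, by rw [pow_one, he]⟩
  have hord : addOrderOf e = p := addOrderOf_eq_prime he he0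
  have hcard : Nat.card (AddCommGroup.primaryComponent A p) = p := by
    rw [heq, Nat.card_zmultiples, hord]
  have : IsAddCyclic (AddCommGroup.primaryComponent A p) :=
    isAddCyclic_of_prime_card hcard
  have := zmodAddCyclicAddEquiv (G := AddCommGroup.primaryComponent A p) inferInstance
  rw [hcard] at this
  exact ⟨this.symm⟩

end primary

section linked

variable {R : Type} [CommRing R]

/-- The integers, regarded as a module over `R` via a ring homomorphism `φ : R →+* ℤ`. -/
def MarkInt (_φ : R →+* ℤ) : Type := ℤ

instance (φ : R →+* ℤ) : AddCommGroup (MarkInt φ) := inferInstanceAs (AddCommGroup ℤ)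

instance (φ : R →+* ℤ) : Module R (MarkInt φ) := Module.compHom ℤ φ

/-- The underlying integer of an element of `MarkInt φ`. -/
def MarkInt.toInt {φ : R →+* ℤ} : MarkInt φ ≃+ ℤ := AddEquiv.refl ℤ

/-- Two ring homomorphisms `φ, ψ : R →+* ℤ` that are congruent modulo `p` and such that, up to an
integer factor `s` prime to `p`, the pairs `(p, 0)`, `(0, p)` and `(1, 1)` are realized by elements
of `R` supported at `φ` and `ψ` only. -/
structure Linked (p s : ℕ) (φ ψ : R →+* ℤ) : Prop where
  coprime : s.Coprime p
  congr : ∀ x, (p : ℤ) ∣ φ x - ψ x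
  exists_elements : ∃ b c ε : R, φ b = s * p ∧ ψ b = 0 ∧ φ c = 0 ∧ ψ c = s * p ∧
    φ ε = s ∧ ψ ε = s ∧ (∀ x, x * b = φ x * b) ∧ (∀ x, x * c = ψ x * c) ∧
    (∀ x (k : ℤ), φ x = 0 → ψ x = p * k → ε * x = k * c) ∧
    (∀ x (k : ℤ), ψ x = 0 → φ x = p * k → ε * x = k * b)

variable {p s : ℕ} {φ ψ : R →+* ℤ}

lemma Linked.symm (h : Linked p s φ ψ) : Linked p s ψ φ where
  coprime := h.coprime
  congr x := by rw [← dvd_neg, neg_sub]; exact h.congr x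
  exists_elements := by
    obtain ⟨b, c, ε, h₁, h₂, h₃, h₄, h₅, h₆, h₇, h₈, h₉, h₁₀⟩ := h.exists_elements
    exact ⟨c, b, ε, h₄, h₃, h₂, h₁, h₆, h₅, h₈, h₇, h₁₀, h₉⟩

/-- The homomorphism `φ`, as a map of `R`-modules. -/
def markMap (φ : R →+* ℤ) : R →ₗ[R] MarkInt φ where
  toFun x := φ x
  map_add' := map_add φ
  map_smul' := map_mul φ

/-- The short complex `ker φ → R → ℤ_φ`. -/
abbrev markComplex (φ : R →+* ℤ) : ShortComplex (ModuleCat.{0} R) where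
  X₁ := ModuleCat.of R (RingHom.ker φ)
  X₂ := ModuleCat.of R R
  X₃ := ModuleCat.of R (MarkInt φ)
  f := ModuleCat.ofHom (Submodule.subtype _)
  g := ModuleCat.ofHom (markMap φ)
  zero := by
    ext x
    exact x.2

lemma markComplex_shortExact (φ : R →+* ℤ) : (markComplex φ).ShortExact where
  exact := by
    rw [ShortComplex.moduleCat_exact_iff]
    intro x hx
    exact ⟨⟨x, hx⟩, rfl⟩
  mono_f := (ModuleCat.mono_iff_injective _).mpr Subtype.val_injective
  epi_g := (ModuleCat.epi_iff_surjective _).mpr fun n => ⟨(MarkInt.toInt (φ := φ) n : R), by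
    exact (map_intCast φ _).trans Int.cast_id⟩

instance (φ : R →+* ℤ) : Projective (markComplex φ).X₂ :=
  ModuleCat.projective_of_free (M := ModuleCat.of R R) (Module.Basis.singleton Unit R)

/-- On `ker φ`, the values of `ψ` are divisible by `p`; this is `ψ / p`. -/
lemma Linked.exists_ret (h : Linked p s φ ψ) (hp : p ≠ 0) :
    ∃ r : RingHom.ker φ →ₗ[R] MarkInt ψ, ∀ x : RingHom.ker φ, ψ x = p * (r x).toInt := by
  have hp' : (p : ℤ) ≠ 0 := by exact_mod_cast hp
  have hdvd : ∀ x : RingHom.ker φ, (p : ℤ) ∣ ψ x := fun x => by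
    have := h.congr x
    rwa [(RingHom.mem_ker).mp x.2, zero_sub, dvd_neg] at this
  choose r hr using hdvd
  refine ⟨⟨⟨r, fun x y => ?_⟩, fun a x => ?_⟩, hr⟩
  · apply MarkInt.toInt.injective
    apply mul_left_cancel₀ hp'
    change (p : ℤ) * r (x + y) = p * (r x + r y)
    rw [mul_add, ← hr, ← hr, ← hr, ← map_add]; rfl
  · apply MarkInt.toInt.injective
    apply mul_left_cancel₀ hp'
    change (p : ℤ) * r (a • x) = p * (ψ a * r x)
    rw [mul_left_comm, ← hr, ← hr, ← map_mul]; rfl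

lemma smul_id_markInt {ε : R} (h : φ ε = s) :
    ε • 𝟙 (ModuleCat.of R (MarkInt φ)) = (s : R) • 𝟙 (ModuleCat.of R (MarkInt φ)) := by
  ext x
  apply (MarkInt.toInt (φ := φ)).injective
  change φ ε * MarkInt.toInt (φ := φ) x = φ s * MarkInt.toInt (φ := φ) x
  rw [h, map_natCast]

lemma smul_ext_of_smul_id {X M : ModuleCat.{0} R} {ε : R} (hM : ε • 𝟙 M = (s : R) • 𝟙 M) {n : ℕ}
    (x : Abelian.Ext X M n) : ε • x = s • x := by
  rw [Abelian.Ext.smul_eq_comp_mk₀, hM, ← Abelian.Ext.smul_eq_comp_mk₀, Nat.cast_smul_eq_nsmul]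

/-- Dimension shifting interchanges `φ` and `ψ`, away from `s`. -/
lemma Linked.nonempty_primaryComponent_ext_succ (h : Linked p s φ ψ) (hp : p ≠ 0)
    (M : ModuleCat.{0} R) (hM : ∀ ε : R, φ ε = s → ψ ε = s → ε • 𝟙 M = (s : R) • 𝟙 M) (n : ℕ) :
    Nonempty (AddCommGroup.primaryComponent
        (Abelian.Ext (ModuleCat.of R (MarkInt φ)) M (n + 2)) p ≃+
      AddCommGroup.primaryComponent
        (Abelian.Ext (ModuleCat.of R (MarkInt ψ)) M (n + 1)) p) := by
  obtain ⟨b, c, ε, hφb, hψb, hφc, hψc, hφε, hψε, hb, hc, hεc, -⟩ := h.exists_elements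
  obtain ⟨r, hr⟩ := h.exists_ret hp
  have hp' : (p : ℤ) ≠ 0 := by exact_mod_cast hp
  let i : MarkInt ψ →ₗ[R] RingHom.ker φ :=
    { toFun := fun k => ⟨(k.toInt : R) * c, by rw [RingHom.mem_ker, map_mul, hφc, mul_zero]⟩
      map_add' := fun k l => Subtype.ext (by
        change ((k.toInt + l.toInt : ℤ) : R) * c = _
        rw [Int.cast_add, add_mul]; rfl)
      map_smul' := fun a k => Subtype.ext (by
        change ((ψ a * k.toInt : ℤ) : R) * c = a * ((k.toInt : R) * c)
        rw [mul_left_comm, hc a, Int.cast_mul]; ring) }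
  have hir : i ∘ₗ r = ε • LinearMap.id := by
    ext x
    exact (hεc x (r x).toInt x.2 (hr x)).symm
  have hri : r ∘ₗ i = ε • LinearMap.id := by
    ext x
    apply MarkInt.toInt.injective
    apply mul_left_cancel₀ hp'
    refine (hr (i x)).symm.trans ?_
    change ψ ((x.toInt : R) * c) = p * (ψ ε * x.toInt)
    rw [map_mul, map_intCast, hψc, hψε, Int.cast_id]; ring
  let I := ModuleCat.ofHom i
  let Q := ModuleCat.ofHom r
  have hIQ : I ≫ Q = ε • 𝟙 _ := by
    rw [← ModuleCat.ofHom_comp, hri]; rfl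
  have hQI : Q ≫ I = ε • 𝟙 _ := by
    rw [← ModuleCat.ofHom_comp, hir]; rfl
  have hsm : ∀ {X : ModuleCat.{0} R} (x : Abelian.Ext X M (n + 1)),
      (Abelian.Ext.mk₀ (ε • 𝟙 X)).comp x (zero_add _) = s • x := fun x => by
    rw [Abelian.Ext.mk₀_smul, Abelian.Ext.smul_comp, Abelian.Ext.mk₀_id_comp,
      smul_ext_of_smul_id (hM ε hφε hψε)]
  have hS := markComplex_shortExact φ
  let δ : Abelian.Ext (markComplex φ).X₁ M (n + 1) →+
      Abelian.Ext (ModuleCat.of R (MarkInt φ)) M (n + 2) :=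
    hS.extClass.precomp M (by omega : 1 + (n + 1) = n + 2)
  have hδ : Function.Bijective δ := by
    constructor
    · rw [injective_iff_map_eq_zero]
      intro x hx
      obtain ⟨y, rfl⟩ := Abelian.Ext.contravariant_sequence_exact₁ hS M x
        (by omega : 1 + (n + 1) = n + 2) hx
      rw [Abelian.Ext.eq_zero_of_projective y, Abelian.Ext.comp_zero]
    · intro x
      exact Abelian.Ext.contravariant_sequence_exact₃ hS M x
        (Abelian.Ext.eq_zero_of_projective _) (by omega : 1 + (n + 1) = n + 2)
  let e := AddEquiv.ofBijective δ hδ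
  let α := (Abelian.Ext.mk₀ I).precomp M (zero_add (n + 1))
  let β := (Abelian.Ext.mk₀ Q).precomp M (zero_add (n + 1))
  refine nonempty_primaryComponent_addEquiv h.coprime (α.comp e.symm.toAddMonoidHom)
    (e.toAddMonoidHom.comp β) (fun x => ?_) (fun x => ?_)
  · change e (β (α (e.symm x))) = _
    have : ∀ y, β (α y) = s • y := fun y => by
      refine (Abelian.Ext.mk₀_comp_mk₀_assoc _ _ _).trans ?_
      rw [hQI]
      exact hsm y
    rw [this, map_nsmul, e.apply_symm_apply]
  · change α (e.symm (e (β x))) = _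
    rw [e.symm_apply_apply]
    refine (Abelian.Ext.mk₀_comp_mk₀_assoc _ _ _).trans ?_
    rw [hIQ]
    exact hsm x

lemma Linked.ext_one_self_eq_zero (h : Linked p s φ ψ) (hp : p ≠ 0) (hs : s ≠ 0)
    (x : Abelian.Ext (ModuleCat.of R (MarkInt φ)) (ModuleCat.of R (MarkInt φ)) 1) : x = 0 := by
  obtain ⟨b, c, ε, hφb, hψb, hφc, hψc, hφε, hψε, hb, hc, hεc, -⟩ := h.exists_elements
  obtain ⟨y, rfl⟩ := Abelian.Ext.contravariant_sequence_exact₃ (markComplex_shortExact φ) _ x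
    (Abelian.Ext.eq_zero_of_projective _) (add_zero 1)
  obtain ⟨f, rfl⟩ := (Abelian.Ext.mk₀_bijective _ _).surjective y
  have : f = 0 := by
    ext t
    have h₁ : f.hom (b • t) = 0 := by
      have : b • t = 0 := Subtype.ext (by
        change b * t.1 = 0
        rw [mul_comm, hb, (RingHom.mem_ker).mp t.2, Int.cast_zero, zero_mul])
      rw [this, map_zero]
    rw [map_smul] at h₁
    have h₂ : φ b * MarkInt.toInt (φ := φ) (f.hom t) = 0 := h₁
    rw [hφb, mul_eq_zero] at h₂
    refine h₂.resolve_left ?_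
    exact_mod_cast mul_ne_zero hs hp
  rw [this, Abelian.Ext.mk₀_zero, Abelian.Ext.comp_zero]

lemma Linked.nonempty_primaryComponent_ext_one [Fact p.Prime] (h : Linked p s φ ψ)
    (hs : s ≠ 0) :
    Nonempty (AddCommGroup.primaryComponent
      (Abelian.Ext (ModuleCat.of R (MarkInt φ)) (ModuleCat.of R (MarkInt ψ)) 1) p ≃+ ZMod p) := by
  have hp : p ≠ 0 := (Fact.out : p.Prime).ne_zero
  obtain ⟨b, c, ε, hφb, hψb, hφc, hψc, hφε, hψε, hb, hc, hεc, -⟩ := h.exists_elements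
  obtain ⟨r, hr⟩ := h.exists_ret hp
  have hS := markComplex_shortExact φ
  let M := ModuleCat.of R (MarkInt ψ)
  let Q : (markComplex φ).X₁ ⟶ M := ModuleCat.ofHom r
  let δ : ((markComplex φ).X₁ ⟶ M) →+ Abelian.Ext (markComplex φ).X₃ M 1 :=
    (hS.extClass.precomp M (add_zero 1)).comp Abelian.Ext.addEquiv₀.symm.toAddMonoidHom
  have hδ : ∀ f, δ f = hS.extClass.comp (Abelian.Ext.mk₀ f) (add_zero 1) := fun _ => rfl
  refine nonempty_primaryComponent_addEquiv_zmod h.coprime (δ Q) ?_ ?_ ?_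
  · have : p • Q = (markComplex φ).f ≫ ModuleCat.ofHom (markMap ψ) := by
      ext t
      apply (MarkInt.toInt (φ := ψ)).injective
      change p • (r t).toInt = ψ t.1
      rw [hr, nsmul_eq_mul]
    rw [← map_nsmul, this, hδ, ← Abelian.Ext.mk₀_comp_mk₀]
    exact hS.extClass_comp_assoc _
  · intro h0
    obtain ⟨y, hy⟩ := Abelian.Ext.contravariant_sequence_exact₁ hS M _ (add_zero 1) h0
    obtain ⟨g, rfl⟩ := (Abelian.Ext.mk₀_bijective _ _).surjective y
    have hy : (markComplex φ).f ≫ g = Q := by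
      apply (Abelian.Ext.mk₀_bijective _ _).injective
      rw [← Abelian.Ext.mk₀_comp_mk₀]; exact hy
    have h₁ : g.hom c = r ⟨c, hφc⟩ := by
      have := congrArg (fun q => q.hom (⟨c, hφc⟩ : RingHom.ker φ)) hy
      exact this
    have h₂ : MarkInt.toInt (φ := ψ) (g.hom c) = ψ c * MarkInt.toInt (φ := ψ) (g.hom (1 : R)) := by
      have : g.hom (c • (1 : R)) = c • g.hom (1 : R) := map_smul _ _ _
      rw [smul_eq_mul, mul_one] at this
      exact congrArg (MarkInt.toInt (φ := ψ)) this
    have h₃ := hr ⟨c, hφc⟩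
    rw [← h₁, h₂] at h₃
    change ψ c = _ at h₃
    have hψ0 : ψ c ≠ 0 := by rw [hψc]; exact_mod_cast mul_ne_zero hs hp
    have h₄ : (p : ℤ) * MarkInt.toInt (φ := ψ) (g.hom (1 : R)) = 1 := by
      apply mul_left_cancel₀ hψ0
      rw [mul_one, mul_left_comm]; exact h₃.symm
    have h₅ : (p : ℤ) ∣ 1 := ⟨_, h₄.symm⟩
    exact (Fact.out : p.Prime).one_lt.ne' (by exact_mod_cast Int.eq_one_of_dvd_one (by simp) h₅)
  · intro x
    obtain ⟨y, rfl⟩ := Abelian.Ext.contravariant_sequence_exact₃ hS M x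
      (Abelian.Ext.eq_zero_of_projective _) (add_zero 1)
    obtain ⟨f, rfl⟩ := (Abelian.Ext.mk₀_bijective _ _).surjective y
    let k : ℤ := MarkInt.toInt (φ := ψ) (f.hom (⟨c, hφc⟩ : RingHom.ker φ))
    refine ⟨k, ?_⟩
    rw [← hδ, ← map_nsmul, ← map_zsmul]
    congr 1
    ext t
    apply (MarkInt.toInt (φ := ψ)).injective
    change s • MarkInt.toInt (φ := ψ) (f.hom t) = k • (r t).toInt
    have h₁ : ε • t = (r t).toInt • (⟨c, hφc⟩ : RingHom.ker φ) := Subtype.ext (by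
      refine (hεc t.1 (r t).toInt t.2 (hr t)).trans ?_
      change _ = (r t).toInt • c
      rw [zsmul_eq_mul])
    have h₂ : f.hom (ε • t) = (r t).toInt • f.hom (⟨c, hφc⟩ : RingHom.ker φ) := by
      rw [h₁]; exact map_zsmul f.hom (r t).toInt _
    rw [map_smul] at h₂
    have h₃ : ψ ε * MarkInt.toInt (φ := ψ) (f.hom t) = (r t).toInt * k :=
      (congrArg (MarkInt.toInt (φ := ψ)) h₂).trans (map_zsmul (MarkInt.toInt (φ := ψ)) _ _)
    rw [hψε] at h₃
    rw [nsmul_eq_mul, smul_eq_mul, h₃, mul_comm]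

lemma Linked.primaryComponent_ext [Fact p.Prime] (n : ℕ) (h : Linked p s φ ψ) (hs : s ≠ 0) :
    (Odd (n + 1) → AddCommGroup.primaryComponent (Abelian.Ext (ModuleCat.of R (MarkInt φ))
        (ModuleCat.of R (MarkInt φ)) (n + 1)) p = ⊥) ∧
    (Even (n + 1) → Nonempty (AddCommGroup.primaryComponent (Abelian.Ext
        (ModuleCat.of R (MarkInt φ)) (ModuleCat.of R (MarkInt φ)) (n + 1)) p ≃+ ZMod p)) ∧
    (Odd (n + 1) → Nonempty (AddCommGroup.primaryComponent (Abelian.Ext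
        (ModuleCat.of R (MarkInt φ)) (ModuleCat.of R (MarkInt ψ)) (n + 1)) p ≃+ ZMod p)) ∧
    (Even (n + 1) → AddCommGroup.primaryComponent (Abelian.Ext (ModuleCat.of R (MarkInt φ))
        (ModuleCat.of R (MarkInt ψ)) (n + 1)) p = ⊥) := by
  have hp : p ≠ 0 := (Fact.out : p.Prime).ne_zero
  induction n generalizing φ ψ with
  | zero =>
    refine ⟨fun _ => ?_, fun h2 => absurd h2 (by decide), fun _ =>
      h.nonempty_primaryComponent_ext_one hs, fun h2 => absurd h2 (by decide)⟩
    rw [AddSubgroup.eq_bot_iff_forall]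
    exact fun x _ => h.ext_one_self_eq_zero hp hs x
  | succ n ih =>
    obtain ⟨i₁, i₂, i₃, i₄⟩ := ih h.symm
    obtain ⟨e₁⟩ := h.nonempty_primaryComponent_ext_succ hp (ModuleCat.of R (MarkInt φ))
      (fun _ h₁ _ => smul_id_markInt h₁) n
    obtain ⟨e₂⟩ := h.nonempty_primaryComponent_ext_succ hp (ModuleCat.of R (MarkInt ψ))
      (fun _ _ h₂ => smul_id_markInt h₂) n
    rw [Nat.even_add_one (n := n + 1), Nat.odd_add_one (n := n + 1), Nat.not_even_iff_odd,
      Nat.not_odd_iff_even]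
    exact ⟨fun hn => primaryComponent_eq_bot_of_addEquiv e₁ (i₄ hn),
      fun hn => (i₃ hn).map e₁.trans, fun hn => (i₂ hn).map e₂.trans,
      fun hn => primaryComponent_eq_bot_of_addEquiv e₂ (i₁ hn)⟩

end linked

section marks

variable {G : Type} [Group G]

lemma mem_map_conj {K : Subgroup G} {g x : G} :
    x ∈ K.map (MulAut.conj g).toMonoidHom ↔ g⁻¹ * x * g ∈ K := by
  constructor
  · rintro ⟨y, hy, rfl⟩
    simpa [mul_assoc] using hy
  · intro h
    exact ⟨_, h, by simp [mul_assoc]⟩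

lemma IsConjSubgroup.symm {K L : Subgroup G} (h : IsConjSubgroup K L) : IsConjSubgroup L K := by
  obtain ⟨g, rfl⟩ := h
  refine ⟨g⁻¹, ?_⟩
  ext x
  simp [mul_assoc]

lemma IsConjSubgroup.trans {K L M : Subgroup G} (h : IsConjSubgroup K L)
    (h' : IsConjSubgroup L M) : IsConjSubgroup K M := by
  obtain ⟨g, rfl⟩ := h
  obtain ⟨g', rfl⟩ := h'
  refine ⟨g' * g, ?_⟩
  ext x
  simp [mul_assoc]

lemma isConjSubgroup_refl (K : Subgroup G) : IsConjSubgroup K K :=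
  ⟨1, by ext x; simp⟩

lemma IsConjSubgroup.card_eq {K L : Subgroup G} (h : IsConjSubgroup K L) :
    Nat.card K = Nat.card L := by
  obtain ⟨g, rfl⟩ := h
  exact Nat.card_congr (K.equivMapOfInjective _ (MulAut.conj g).injective).toEquiv

/-- Elements of the Burnside ring are constant on conjugacy classes. -/
lemma burnsideRing_apply_eq {a : Subgroup G → ℤ} (ha : a ∈ burnsideRing G) {K L : Subgroup G}
    (h : IsConjSubgroup K L) : a K = a L := by
  obtain ⟨g, rfl⟩ := h
  induction ha using Subring.closure_induction with
  | mem a ha =>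
    obtain ⟨X, _, _, rfl⟩ := ha
    refine congrArg Nat.cast (Nat.card_congr ((MulAction.toPerm g).subtypeEquiv fun x => ?_))
    change x ∈ MulAction.fixedPoints K X ↔ g • x ∈ MulAction.fixedPoints _ X
    constructor
    · rintro h ⟨y, hy⟩
      have := h ⟨_, mem_map_conj.mp hy⟩
      change (g⁻¹ * y * g) • x = x at this
      change y • g • x = g • x
      rwa [mul_smul, mul_smul, inv_smul_eq_iff] at this
    · rintro h ⟨y, hy⟩
      have : (g * y * g⁻¹) • g • x = g • x := h ⟨g * y * g⁻¹, ⟨y, hy, rfl⟩⟩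
      rw [smul_smul, inv_mul_cancel_right, mul_smul] at this
      exact smul_left_cancel g this
  | zero => rfl
  | one => rfl
  | add a b _ _ ha hb => exact congrArg₂ (· + ·) ha hb
  | neg a _ ha => exact congrArg Neg.neg ha
  | mul a b _ _ ha hb => exact congrArg₂ (· * ·) ha hb

/-- If `K` is normal in `S` with `S / K` a `p`-group, the marks at `K` and `S` agree mod `p`. -/
lemma dvd_burnsideRing_apply_sub {p : ℕ} [Fact p.Prime] {a : Subgroup G → ℤ}
    (ha : a ∈ burnsideRing G) {K S : Subgroup G} (hKS : K ≤ S)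
    (hS : S ≤ Subgroup.normalizer K) (hpow : ∀ x ∈ S, ∃ k, x ^ p ^ k ∈ K) :
    (p : ℤ) ∣ a K - a S := by
  induction ha using Subring.closure_induction with
  | mem a ha =>
    obtain ⟨X, _, _, rfl⟩ := ha
    have hmem : ∀ (s : S) (x : MulAction.fixedPoints K X),
        (s : G) • (x : X) ∈ MulAction.fixedPoints K X := by
      rintro ⟨s, hs⟩ ⟨x, hx⟩ ⟨k, hk⟩
      have := hx ⟨s⁻¹ * k * s, (Subgroup.mem_normalizer_iff''.mp (hS hs) k).mp hk⟩
      change (s⁻¹ * k * s) • x = x at this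
      change k • s • x = s • x
      rw [mul_smul, mul_smul, inv_smul_eq_iff] at this
      exact this
    let act : MulAction S (MulAction.fixedPoints K X) :=
      { smul := fun s x => ⟨(s : G) • (x : X), hmem s x⟩
        one_smul := fun x => Subtype.ext (one_smul G (x : X))
        mul_smul := fun s t x => Subtype.ext (mul_smul (s : G) (t : G) (x : X)) }
    have hact : ∀ (s : S) (x : MulAction.fixedPoints K X),
        ((s • x : MulAction.fixedPoints K X) : X) = (s : G) • (x : X) := fun _ _ => rfl
    let f := MulAction.toPermHom S (MulAction.fixedPoints K X)
    have hf : IsPGroup p f.range := by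
      rintro ⟨_, s, rfl⟩
      obtain ⟨k, hk⟩ := hpow s s.2
      refine ⟨k, Subtype.ext ?_⟩
      change (f s) ^ p ^ k = 1
      rw [← map_pow]
      ext x
      exact x.2 ⟨_, hk⟩
    have := hf.card_modEq_card_fixedPoints (MulAction.fixedPoints K X)
    have h2 : Nat.card (MulAction.fixedPoints f.range (MulAction.fixedPoints K X)) =
        Nat.card (MulAction.fixedPoints S X) := by
      refine Nat.card_congr
        { toFun := fun x => ⟨x.1.1, fun s => ?_⟩
          invFun := fun x => ⟨⟨x.1, fun k => x.2 ⟨k, hKS k.2⟩⟩, ?_⟩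
          left_inv := fun _ => rfl
          right_inv := fun _ => rfl }
      · exact congrArg Subtype.val (x.2 ⟨f s, s, rfl⟩)
      · rintro ⟨_, s, rfl⟩
        exact Subtype.ext (x.2 s)
    rw [h2] at this
    exact (Nat.modEq_iff_dvd.mp this.symm)
  | zero => simp
  | one => simp
  | add a b _ _ ha hb =>
    change (p : ℤ) ∣ (a K + b K) - (a S + b S)
    rw [add_sub_add_comm]
    exact dvd_add ha hb
  | neg a _ ha =>
    change (p : ℤ) ∣ -a K - -a S
    rwa [neg_sub_neg, ← dvd_neg, neg_sub]
  | mul a b _ _ ha hb =>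
    change (p : ℤ) ∣ a K * b K - a S * b S
    have : a K * b K - a S * b S = (a K - a S) * b K + a S * (b K - b S) := by ring
    rw [this]
    exact dvd_add (ha.mul_right _) (hb.mul_left _)

/-- The congruence modulo `p` of the marks at two subgroups. -/
def MarkCongr (p : ℕ) (K L : Subgroup G) : Prop :=
  ∀ a ∈ burnsideRing G, (p : ℤ) ∣ a K - a L

lemma MarkCongr.symm {p : ℕ} {K L : Subgroup G} (h : MarkCongr p K L) : MarkCongr p L K :=
  fun a ha => by rw [← dvd_neg, neg_sub]; exact h a ha

lemma MarkCongr.trans {p : ℕ} {K L M : Subgroup G} (h : MarkCongr p K L) (h' : MarkCongr p L M) :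
    MarkCongr p K M := fun a ha => by
  have := dvd_add (h a ha) (h' a ha)
  rwa [sub_add_sub_cancel] at this

lemma IsConjSubgroup.markCongr {K L : Subgroup G} (h : IsConjSubgroup K L) (p : ℕ) :
    MarkCongr p K L := fun a ha => by
  rw [burnsideRing_apply_eq ha h, sub_self]
  exact dvd_zero _

lemma markCongr_op [Finite G] (p : ℕ) [Fact p.Prime] (H : Subgroup G) :
    MarkCongr p (Op p H) H := fun a ha => by
  refine dvd_burnsideRing_apply_sub ha (Subgroup.map_subtype_le _) ?_ ?_
  · intro x hx
    rw [Subgroup.mem_normalizer_iff]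
    have : ∀ x ∈ H, ∀ y ∈ Op p H, x * y * x⁻¹ ∈ Op p H := by
      rintro x hx _ ⟨y, hy, rfl⟩
      refine ⟨⟨x, hx⟩ * y * ⟨x, hx⟩⁻¹, ?_, rfl⟩
      simp only [Subgroup.coe_sInf, Set.mem_iInter, SetLike.mem_coe] at hy ⊢
      exact fun K hK => hK.1.conj_mem _ (hy K hK) _
    refine fun y => ⟨this x hx y, fun hy => ?_⟩
    have := this x⁻¹ (H.inv_mem hx) _ hy
    rwa [inv_inv, mul_assoc, inv_mul_cancel_right, inv_mul_cancel_left] at this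
  · intro x hx
    have hex : ∀ K : {K : Subgroup H | ∃ _ : K.Normal, IsPGroup p (H ⧸ K)},
        ∃ k, (⟨x, hx⟩ : H) ^ p ^ k ∈ K.1 := by
      rintro ⟨K, hK, hp⟩
      obtain ⟨k, hk⟩ := hp (QuotientGroup.mk ⟨x, hx⟩)
      exact ⟨k, (QuotientGroup.eq_one_iff _).mp hk⟩
    choose k hk using hex
    obtain ⟨n, hn⟩ := (Set.finite_range k).bddAbove
    refine ⟨n, ⟨⟨x, hx⟩ ^ p ^ n, ?_, rfl⟩⟩
    simp only [Subgroup.coe_sInf, Set.mem_iInter, SetLike.mem_coe]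
    intro K hK
    have := hn (Set.mem_range_self ⟨K, hK⟩)
    rw [← Nat.add_sub_cancel' this, pow_add, pow_mul]
    exact K.pow_mem (hk ⟨K, hK⟩) _

lemma mk_mem_fixedPoints_iff {K L : Subgroup G} {g : G} :
    (g : G ⧸ K) ∈ MulAction.fixedPoints L (G ⧸ K) ↔
      L ≤ K.map (MulAut.conj g).toMonoidHom := by
  constructor
  · intro h x hx
    rw [mem_map_conj]
    have := QuotientGroup.eq.mp (h ⟨x, hx⟩).symm
    simpa [mul_assoc] using this
  · rintro h ⟨x, hx⟩
    refine (QuotientGroup.eq.mpr ?_).symm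
    have := mem_map_conj.mp (h hx)
    simpa [mul_assoc] using this

lemma mem_normalizer_iff_map_conj {K : Subgroup G} {g : G} :
    g ∈ Subgroup.normalizer (K : Set G) ↔ K = K.map (MulAut.conj g).toMonoidHom := by
  rw [Subgroup.mem_normalizer_iff'', SetLike.ext_iff]
  simp only [mem_map_conj]

/-- The marks of the transitive `G`-set `G / K`. -/
def cosetMark (K L : Subgroup G) : ℕ :=
  Nat.card (MulAction.fixedPoints L (G ⧸ K))

lemma exists_le_map_conj {K L : Subgroup G} (h : cosetMark K L ≠ 0) :
    ∃ g : G, L ≤ K.map (MulAut.conj g).toMonoidHom := by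
  obtain ⟨⟨x, hx⟩⟩ := (Nat.card_ne_zero.mp h).1
  obtain ⟨g, rfl⟩ := QuotientGroup.mk_surjective x
  exact ⟨g, mk_mem_fixedPoints_iff.mp hx⟩

lemma card_mul_cosetMark (K L : Subgroup G) : Nat.card K * cosetMark K L =
    Nat.card {g : G | L ≤ K.map (MulAut.conj g).toMonoidHom} := by
  rw [cosetMark, ← Nat.card_prod,
    ← Nat.card_congr (QuotientGroup.preimageMkEquivSubgroupProdSet K _)]
  congr 2
  ext g
  exact mk_mem_fixedPoints_iff

variable [Finite G]

lemma cosetMark_mem (K : Subgroup G) : (fun L => (cosetMark K L : ℤ)) ∈ burnsideRing G :=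
  Subring.subset_closure ⟨G ⧸ K, Fintype.ofFinite _, inferInstance, rfl⟩

lemma eq_map_conj_of_le {K : Subgroup G} {g : G} (h : K ≤ K.map (MulAut.conj g).toMonoidHom) :
    K = K.map (MulAut.conj g).toMonoidHom :=
  Subgroup.eq_of_le_of_card_ge h (IsConjSubgroup.card_eq ⟨g, rfl⟩).ge

lemma card_mul_cosetMark_self (K : Subgroup G) : Nat.card K * cosetMark K K =
    Nat.card (Subgroup.normalizer (K : Set G)) := by
  rw [card_mul_cosetMark]
  refine Nat.card_congr (Equiv.subtypeEquivRight fun g => ?_)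
  exact ⟨fun h => mem_normalizer_iff_map_conj.mpr (eq_map_conj_of_le h),
    fun h => (mem_normalizer_iff_map_conj.mp h).le⟩

lemma cosetMark_self_dvd (K L : Subgroup G) : cosetMark K K ∣ cosetMark K L := by
  have hN : Nat.card (Subgroup.normalizer (K : Set G)) ∣
      Nat.card {g : G | L ≤ K.map (MulAut.conj g).toMonoidHom} := by
    let T := {g : G | L ≤ K.map (MulAut.conj g).toMonoidHom}
    have hT : (QuotientGroup.mk : G → G ⧸ Subgroup.normalizer (K : Set G)) ⁻¹'
        (QuotientGroup.mk '' T) = T := by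
      refine Set.Subset.antisymm ?_ (Set.subset_preimage_image _ _)
      rintro g ⟨t, ht, htg⟩
      have hn := QuotientGroup.eq.mp htg
      intro x hx
      have h₁ := mem_map_conj.mp (ht hx)
      have h₂ := (Subgroup.mem_normalizer_iff''.mp hn _).mp h₁
      rw [mem_map_conj]
      simpa [mul_assoc] using h₂
    change _ ∣ Nat.card T
    rw [← hT, Nat.card_congr (QuotientGroup.preimageMkEquivSubgroupProdSet _ _), Nat.card_prod]
    exact dvd_mul_right _ _
  rw [← card_mul_cosetMark, ← card_mul_cosetMark_self] at hN
  exact Nat.dvd_of_mul_dvd_mul_left Nat.card_pos hN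

lemma card_mul_cosetMark_self_dvd (K : Subgroup G) :
    Nat.card K * cosetMark K K ∣ Nat.card G := by
  rw [card_mul_cosetMark_self]
  exact Subgroup.card_subgroup_dvd_card _

lemma cosetMark_self_ne_zero (K : Subgroup G) : cosetMark K K ≠ 0 := fun h => by
  have := card_mul_cosetMark_self K
  rw [h, mul_zero] at this
  exact Nat.card_pos.ne this

/-- The cokernel of the ghost embedding is annihilated by the order of the group. -/
lemma card_mul_mem_burnsideRing (f : Subgroup G → ℤ)
    (hf : ∀ K L, IsConjSubgroup K L → f K = f L) :
    (fun K => (Nat.card G : ℤ) * f K) ∈ burnsideRing G := by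
  suffices H : ∀ (n : ℕ) (U : Set (Subgroup G)), U.ncard = n →
      (∀ K ∈ U, ∀ g : G, ∀ L ≤ K.map (MulAut.conj g).toMonoidHom, L ∈ U) →
      ∀ f : Subgroup G → ℤ, (∀ K L, IsConjSubgroup K L → f K = f L) →
      (∀ K ∉ U, f K = 0) → (fun K => (Nat.card G : ℤ) * f K) ∈ burnsideRing G from
    H _ Set.univ rfl (fun _ _ _ _ _ => trivial) f hf fun K hK => absurd trivial hK
  intro n
  induction n using Nat.strong_induction_on with
  | _ n ih =>
  rintro U rfl hU f hf hfU
  by_cases hne : U.Nonempty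
  · obtain ⟨K, hK, hmax⟩ := Set.exists_max_image U (fun K => Nat.card K) U.toFinite hne
    let U' := U \ {L | IsConjSubgroup K L}
    have hU' : U'.ncard < U.ncard :=
      Set.ncard_lt_ncard ⟨Set.sdiff_subset, fun h => (h hK).2 (isConjSubgroup_refl K)⟩ U.toFinite
    choose q hq using cosetMark_self_dvd K
    obtain ⟨d, hd⟩ : cosetMark K K ∣ Nat.card G :=
      (dvd_mul_left _ _).trans (card_mul_cosetMark_self_dvd K)
    have hpos : (cosetMark K K : ℤ) ≠ 0 := by exact_mod_cast cosetMark_self_ne_zero K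
    have hqK : q K = 1 := by
      have := hq K
      rwa [left_eq_mul₀ (cosetMark_self_ne_zero K)] at this
    have hqconj : ∀ L L', IsConjSubgroup L L' → q L = q L' := fun L L' h => by
      have := burnsideRing_apply_eq (cosetMark_mem K) h
      simp only [Nat.cast_inj] at this
      rw [hq L, hq L'] at this
      exact Nat.eq_of_mul_eq_mul_left (Nat.pos_of_ne_zero (cosetMark_self_ne_zero K)) this
    have hmem := ih _ hU' U' rfl ?_ (fun L => f L - f K * q L) ?_ ?_
    · have hq' : (fun L => (Nat.card G : ℤ) * (f K * q L)) ∈ burnsideRing G := by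
        convert zsmul_mem (cosetMark_mem K) (f K * d) using 1
        ext L
        rw [Pi.smul_apply, hq L, hd, smul_eq_mul]
        push_cast
        ring
      convert add_mem hmem hq' using 1
      ext L
      rw [Pi.add_apply]
      ring
    · rintro L ⟨hL, hL'⟩ g M hM
      refine ⟨hU L hL g M hM, fun hKM => hL' ?_⟩
      have hLg : IsConjSubgroup L (L.map (MulAut.conj g).toMonoidHom) := ⟨g, rfl⟩
      have : M = L.map (MulAut.conj g).toMonoidHom := Subgroup.eq_of_le_of_card_ge hM (by
        rw [← hLg.card_eq, ← hKM.card_eq]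
        exact hmax L hL)
      rw [← this] at hLg
      exact hKM.trans hLg.symm
    · intro L L' h
      rw [hf L L' h, hqconj L L' h]
    · intro L hL
      by_cases hKL : IsConjSubgroup K L
      · rw [← hf K L hKL, ← hqconj K L hKL, hqK]
        simp
      · have hLU : L ∉ U := fun h => hL ⟨h, hKL⟩
        have : q L = 0 := by
          by_contra h0
          obtain ⟨g, hg⟩ := exists_le_map_conj (K := K) (L := L) (by
            rw [hq L]
            exact mul_ne_zero (cosetMark_self_ne_zero K) h0)
          exact hLU (hU K hK g L hg)
        rw [hfU L hLU, this]
        simp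
  · have : (fun K => (Nat.card G : ℤ) * f K) = 0 := by
      ext K
      rw [hfU K fun h => hne ⟨K, h⟩, mul_zero]
      rfl
    rw [this]
    exact zero_mem _

end marks

section classification

variable {G : Type} [Group G] [Finite G] {p : ℕ}

/-- Subgroups with congruent marks whose Weyl groups have order prime to `p` are conjugate. -/
lemma MarkCongr.isConjSubgroup {K L : Subgroup G} (h : MarkCongr p K L)
    (hK : ¬ p ∣ cosetMark K K) (hL : ¬ p ∣ cosetMark L L) : IsConjSubgroup K L := by
  have key : ∀ {K L : Subgroup G}, MarkCongr p K L → ¬ p ∣ cosetMark K K →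
      ∃ g : G, L ≤ K.map (MulAut.conj g).toMonoidHom := fun {K L} h hK => by
    refine exists_le_map_conj fun h0 => hK ?_
    have := h _ (cosetMark_mem K)
    simp only [h0, Nat.cast_zero, sub_zero] at this
    exact Int.natCast_dvd_natCast.mp this
  obtain ⟨g, hg⟩ := key h hK
  obtain ⟨g', hle⟩ := key h.symm hL
  refine ⟨g, (Subgroup.eq_of_le_of_card_ge hg ?_).symm⟩
  rw [← IsConjSubgroup.card_eq ⟨g, rfl⟩, IsConjSubgroup.card_eq (K := L) ⟨g', rfl⟩]
  exact Subgroup.card_le_of_le hle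

/-- If `p` divides the order of the Weyl group of `K`, then `K` is normal of index `p` in some
larger subgroup. -/
lemma exists_normal_extension [hp : Fact p.Prime] {K : Subgroup G} (hK : p ∣ cosetMark K K) :
    ∃ S : Subgroup G, K ≤ S ∧ S ≤ Subgroup.normalizer (K : Set G) ∧ (∀ x ∈ S, x ^ p ∈ K) ∧
      p ∣ Nat.card S := by
  let N := Subgroup.normalizer (K : Set G)
  let K' := K.subgroupOf N
  have hKN : K ≤ N := Subgroup.le_normalizer
  have hcard : Nat.card (N ⧸ K') = cosetMark K K := by
    have h₁ := Subgroup.card_mul_index K'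
    have h₂ := card_mul_cosetMark_self K
    rw [Nat.card_congr (Subgroup.subgroupOfEquivOfLe hKN).toEquiv] at h₁
    exact Nat.eq_of_mul_eq_mul_left Nat.card_pos (h₁.trans h₂.symm)
  obtain ⟨q, hq⟩ := exists_prime_orderOf_dvd_card' p (hcard ▸ hK)
  obtain ⟨x, rfl⟩ := QuotientGroup.mk_surjective q
  refine ⟨((Subgroup.zpowers (x : N ⧸ K')).comap (QuotientGroup.mk' K')).map N.subtype,
    fun y hy => ⟨⟨y, hKN hy⟩, ?_, rfl⟩, Subgroup.map_subtype_le _, ?_, ?_⟩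
  · have : QuotientGroup.mk' K' ⟨y, hKN hy⟩ = 1 := (QuotientGroup.eq_one_iff _).mpr hy
    change QuotientGroup.mk' K' ⟨y, hKN hy⟩ ∈ Subgroup.zpowers (x : N ⧸ K')
    rw [this]
    exact one_mem _
  · rintro _ ⟨y, ⟨n, hn⟩, rfl⟩
    have : (QuotientGroup.mk' K' y) ^ p = 1 := by
      rw [← hn]
      change ((x : N ⧸ K') ^ n) ^ p = 1
      rw [← zpow_natCast, zpow_comm, zpow_natCast, ← hq, pow_orderOf_eq_one, one_zpow]
    rw [← map_pow] at this
    exact (QuotientGroup.eq_one_iff (N := K') (y ^ p)).mp this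
  · have h₁ : p ∣ orderOf x := hq ▸ orderOf_map_dvd (QuotientGroup.mk' K') x
    rw [← orderOf_injective N.subtype N.subtype_injective] at h₁
    refine h₁.trans (Subgroup.orderOf_dvd_natCard _ ?_)
    exact ⟨x, Subgroup.mem_zpowers _, rfl⟩

lemma not_dvd_card_of_dvd_cosetMark (hp2 : ¬ p ^ 2 ∣ Nat.card G) {K : Subgroup G}
    (hK : p ∣ cosetMark K K) : ¬ p ∣ Nat.card K := fun h => hp2 (by
  rw [pow_two]
  exact (mul_dvd_mul h hK).trans (card_mul_cosetMark_self_dvd K))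

/-- If `p²` does not divide `|G|`, conjugacy is detected by congruence of marks and divisibility
of the order of the Weyl group by `p`. -/
lemma MarkCongr.isConjSubgroup_of_iff [hp : Fact p.Prime] (hp2 : ¬ p ^ 2 ∣ Nat.card G)
    {K L : Subgroup G} (h : MarkCongr p K L)
    (hiff : p ∣ cosetMark K K ↔ p ∣ cosetMark L L) : IsConjSubgroup K L := by
  by_cases hK : p ∣ cosetMark K K
  · have hL := hiff.mp hK
    obtain ⟨S, hKS, hSK, hpS, hS⟩ := exists_normal_extension hK
    obtain ⟨T, hLT, hTL, hpT, hT⟩ := exists_normal_extension hL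
    have hST : MarkCongr p S T := by
      have h₁ : MarkCongr p K S := fun a ha =>
        dvd_burnsideRing_apply_sub ha hKS hSK fun x hx => ⟨1, by rw [pow_one]; exact hpS x hx⟩
      have h₂ : MarkCongr p L T := fun a ha =>
        dvd_burnsideRing_apply_sub ha hLT hTL fun x hx => ⟨1, by rw [pow_one]; exact hpT x hx⟩
      exact h₁.symm.trans (h.trans h₂)
    obtain ⟨g, hg⟩ := hST.isConjSubgroup
      (fun h => not_dvd_card_of_dvd_cosetMark hp2 h hS)
      (fun h => not_dvd_card_of_dvd_cosetMark hp2 h hT)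
    have mem_of_pow : ∀ {A B : Subgroup G}, ¬ p ∣ Nat.card B → ∀ x ∈ B, x ^ p ∈ A → x ∈ A := by
      intro A B hB x hx hxA
      obtain ⟨u, v, huv⟩ := Nat.isCoprime_iff_coprime.mpr (hp.out.coprime_iff_not_dvd.mpr hB)
      have hx1 : x ^ Nat.card B = 1 := orderOf_dvd_iff_pow_eq_one.mp (B.orderOf_dvd_natCard hx)
      have : x = (x ^ p) ^ u := by
        calc x = x ^ (p * u + Nat.card B * v : ℤ) := by
              rw [mul_comm, mul_comm _ v, huv, zpow_one]
          _ = (x ^ p) ^ u := by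
              rw [zpow_add, zpow_mul, zpow_mul, zpow_natCast, zpow_natCast, hx1, one_zpow, mul_one]
      exact this ▸ A.zpow_mem hxA u
    refine ⟨g, le_antisymm ?_ ?_⟩
    · have hcard : Nat.card K = Nat.card (K.map (MulAut.conj g).toMonoidHom) :=
        IsConjSubgroup.card_eq ⟨g, rfl⟩
      have hK' := not_dvd_card_of_dvd_cosetMark hp2 hK
      rw [hcard] at hK'
      intro x hx
      exact mem_of_pow hK' x hx (hpT x (hg ▸ Subgroup.map_mono hKS hx))
    · intro x hx
      rw [mem_map_conj]
      have hxS : g⁻¹ * x * g ∈ S := by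
        have := hLT hx
        rwa [← hg, mem_map_conj] at this
      have hxL : g⁻¹ * x * g ∈ L.map (MulAut.conj g⁻¹).toMonoidHom := by
        rw [mem_map_conj]
        simpa [mul_assoc] using hx
      have hL' := not_dvd_card_of_dvd_cosetMark hp2 hL
      rw [IsConjSubgroup.card_eq (K := L) ⟨g⁻¹, rfl⟩] at hL'
      exact mem_of_pow hL' _ hxL (hpS _ hxS)
  · exact h.isConjSubgroup hK fun hL => hK (hiff.mpr hL)

/-- If `p²` does not divide `|G|`, at most two conjugacy classes of subgroups have marks congruent
modulo `p`. -/
lemma MarkCongr.isConjSubgroup_or [Fact p.Prime] (hp2 : ¬ p ^ 2 ∣ Nat.card G)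
    {H J K : Subgroup G} (hHJ : ¬ IsConjSubgroup H J) (h : MarkCongr p H J)
    (hK : MarkCongr p H K) : IsConjSubgroup H K ∨ IsConjSubgroup J K := by
  have h₁ := mt (h.isConjSubgroup_of_iff hp2) hHJ
  by_cases h₂ : p ∣ cosetMark H H ↔ p ∣ cosetMark K K
  · exact Or.inl (hK.isConjSubgroup_of_iff hp2 h₂)
  · exact Or.inr ((h.symm.trans hK).isConjSubgroup_of_iff hp2 (by tauto))

/-- There is an element of the Burnside ring which is, modulo `p`, the indicator function of the
set of subgroups whose marks are congruent to those at `H`. -/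
lemma exists_indicator_mod [hp : Fact p.Prime] (H : Subgroup G) :
    ∃ u ∈ burnsideRing G, ∀ K, (MarkCongr p H K → (p : ℤ) ∣ u K - 1) ∧
      (¬ MarkCongr p H K → (p : ℤ) ∣ u K) := by
  classical
  have : Fintype (Subgroup G) := Fintype.ofFinite _
  have hex : ∀ L : Subgroup G, ∃ v ∈ burnsideRing G,
      (∀ K, MarkCongr p H K → (p : ℤ) ∣ v K - 1) ∧ (¬ MarkCongr p H L → (p : ℤ) ∣ v L) := by
    intro L
    by_cases hL : MarkCongr p H L
    · exact ⟨1, one_mem _, fun K _ => by simp, fun h => absurd hL h⟩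
    · have hL' := hL
      rw [MarkCongr] at hL'
      push Not at hL'
      obtain ⟨a, ha, haL⟩ := hL'
      refine ⟨1 - (a - (a H : ℤ)) ^ (p - 1),
        sub_mem (one_mem _) (pow_mem (sub_mem ha (intCast_mem _ _)) _), fun K hK => ?_,
        fun _ => ?_⟩
      · change (p : ℤ) ∣ 1 - (a K - a H) ^ (p - 1) - 1
        rw [sub_sub_cancel_left, dvd_neg]
        exact dvd_pow (hK.symm a ha) (Nat.sub_ne_zero_of_lt hp.out.one_lt)
      · change (p : ℤ) ∣ 1 - (a L - a H) ^ (p - 1)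
        have hcop : IsCoprime (a L - a H) (p : ℤ) := by
          rw [isCoprime_comm, Prime.coprime_iff_not_dvd (Nat.prime_iff_prime_int.mp hp.out),
            ← dvd_neg, neg_sub]
          exact haL
        exact (Int.ModEq.pow_card_sub_one_eq_one hp.out hcop).dvd
  choose v hv hv₁ hv₀ using hex
  refine ⟨∏ L, v L, prod_mem fun L _ => hv L, fun K => ⟨fun hK => ?_, fun hK => ?_⟩⟩
  · rw [Finset.prod_apply]
    exact (Finset.prod_induction (fun L => v L K) (fun z => (1 : ℤ) ≡ z [ZMOD p])
      (fun _ _ h h' => h.mul h') rfl fun L _ => Int.modEq_iff_dvd.mpr (hv₁ L K hK)).dvd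
  · rw [Finset.prod_apply]
    exact (hv₀ K hK).trans (Finset.dvd_prod_of_mem _ (Finset.mem_univ K))

/-- The mark homomorphism `π_H`. -/
def markHom (H : Subgroup G) : burnsideRing G →+* ℤ :=
  (Pi.evalRingHom (fun _ => ℤ) H).comp (burnsideRing G).subtype

lemma linked_markHom [hp : Fact p.Prime] (hpG : p ∣ Nat.card G) (hp2 : ¬ p ^ 2 ∣ Nat.card G)
    {H J : Subgroup G} (hHJ : ¬ IsConjSubgroup H J) (h : MarkCongr p H J) :
    ∃ s, Linked p s (markHom H) (markHom J) := by
  classical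
  obtain ⟨m, hm⟩ := hpG
  have hcong : ∀ K, MarkCongr p H K ↔ IsConjSubgroup H K ∨ IsConjSubgroup J K := fun K =>
    ⟨h.isConjSubgroup_or hp2 hHJ, fun hK => hK.elim (·.markCongr p)
      fun hK => h.trans (hK.markCongr p)⟩
  have hdisj : ∀ K, IsConjSubgroup H K → ¬ IsConjSubgroup J K := fun K h₁ h₂ =>
    hHJ (h₁.trans h₂.symm)
  let δ : Subgroup G → Subgroup G → ℤ := fun L K => if IsConjSubgroup L K then 1 else 0
  have hδ : ∀ L K K', IsConjSubgroup K K' → δ L K = δ L K' := fun L K K' hK =>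
    if_congr ⟨fun h => h.trans hK, fun h => h.trans hK.symm⟩ rfl rfl
  obtain ⟨u, hu, hu'⟩ := exists_indicator_mod (p := p) H
  have hdvd : ∀ K, (p : ℤ) ∣ u K - (δ H K + δ J K) := fun K => by
    by_cases h₁ : IsConjSubgroup H K
    · simpa [δ, h₁, hdisj K h₁] using (hu' K).1 ((hcong K).mpr (Or.inl h₁))
    · by_cases h₂ : IsConjSubgroup J K
      · simpa [δ, h₁, h₂] using (hu' K).1 ((hcong K).mpr (Or.inr h₂))
      · simpa [δ, h₁, h₂] using (hu' K).2 (by rw [hcong]; tauto)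
  choose w hw using hdvd
  have hp0 : (p : ℤ) ≠ 0 := by exact_mod_cast hp.out.ne_zero
  have hw' : ∀ K K', IsConjSubgroup K K' → w K = w K' := fun K K' hK => by
    apply mul_left_cancel₀ hp0
    rw [← hw, ← hw, burnsideRing_apply_eq hu hK, hδ H K K' hK, hδ J K K' hK]
  have hε : (fun K => (m : ℤ) * (δ H K + δ J K)) ∈ burnsideRing G := by
    convert sub_mem (zsmul_mem hu (m : ℤ)) (card_mul_mem_burnsideRing w hw') using 1
    ext K
    have := hw K
    rw [Pi.sub_apply, Pi.smul_apply, smul_eq_mul, hm]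
    push_cast
    linear_combination -(m : ℤ) * this
  have hmem : ∀ L : Subgroup G, (fun K => (m * p : ℤ) * δ L K) ∈ burnsideRing G := fun L => by
    convert card_mul_mem_burnsideRing (δ L) (hδ L) using 1
    ext K
    rw [hm]
    push_cast
    ring
  have hHH : δ H H = 1 := if_pos (isConjSubgroup_refl H)
  have hJJ : δ J J = 1 := if_pos (isConjSubgroup_refl J)
  have hHJ' : δ H J = 0 := if_neg hHJ
  have hJH : δ J H = 0 := if_neg fun h => hHJ h.symm
  have happ : ∀ (x : burnsideRing G) {L K : Subgroup G}, x.1 K * δ L K = x.1 L * δ L K := by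
    intro x L K
    by_cases hL : IsConjSubgroup L K
    · rw [burnsideRing_apply_eq x.2 hL]
    · rw [show δ L K = 0 from if_neg hL, mul_zero, mul_zero]
  refine ⟨m, ⟨?_, fun x => h x.1 x.2, ⟨_, hmem H⟩, ⟨_, hmem J⟩, ⟨_, hε⟩, ?_, ?_, ?_, ?_, ?_, ?_,
    fun x => ?_, fun x => ?_, fun x k hx₁ hx₂ => ?_, fun x k hx₁ hx₂ => ?_⟩⟩
  · rw [Nat.coprime_comm, hp.out.coprime_iff_not_dvd]
    intro hdvd
    exact hp2 (by rw [hm, pow_two]; exact mul_dvd_mul_left p hdvd)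
  · change (m * p : ℤ) * δ H H = m * p
    rw [hHH, mul_one]
  · change (m * p : ℤ) * δ H J = 0
    rw [hHJ', mul_zero]
  · change (m * p : ℤ) * δ J H = 0
    rw [hJH, mul_zero]
  · change (m * p : ℤ) * δ J J = m * p
    rw [hJJ, mul_one]
  · change (m : ℤ) * (δ H H + δ J H) = m
    rw [hHH, hJH, add_zero, mul_one]
  · change (m : ℤ) * (δ H J + δ J J) = m
    rw [hHJ', hJJ, zero_add, mul_one]
  · ext K
    change x.1 K * (m * p * δ H K) = x.1 H * (m * p * δ H K)
    linear_combination (m * p : ℤ) * happ x (L := H) (K := K)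
  · ext K
    change x.1 K * (m * p * δ J K) = x.1 J * (m * p * δ J K)
    linear_combination (m * p : ℤ) * happ x (L := J) (K := K)
  · ext K
    change x.1 H = 0 at hx₁
    change x.1 J = _ at hx₂
    change (m : ℤ) * (δ H K + δ J K) * x.1 K = k * (m * p * δ J K)
    have h₁ := happ x (L := H) (K := K)
    have h₂ := happ x (L := J) (K := K)
    rw [hx₁] at h₁
    rw [hx₂] at h₂
    linear_combination (m : ℤ) * h₁ + (m : ℤ) * h₂
  · ext K
    change x.1 J = 0 at hx₁
    change x.1 H = _ at hx₂
    change (m : ℤ) * (δ H K + δ J K) * x.1 K = k * (m * p * δ H K)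
    have h₁ := happ x (L := H) (K := K)
    have h₂ := happ x (L := J) (K := K)
    rw [hx₂] at h₁
    rw [hx₁] at h₂
    linear_combination (m : ℤ) * h₁ + (m : ℤ) * h₂

end classification

/-- Let `G` be a finite group and `p` a prime with `p ∣ |G|`, `p² ∤ |G|`, and let `H, J ≤ G`
be non-conjugate subgroups with `O^p(H)` conjugate to `O^p(J)` in `G`.  Then for `l ≥ 1` the
`p`-primary part of `Ext^l_{A(G)}(ℤ_H, ℤ_H)` is `0` for `l` odd and `≅ ℤ/pℤ` for `l` even,
while the `p`-primary part of `Ext^l_{A(G)}(ℤ_H, ℤ_J)` is `≅ ℤ/pℤ` for `l` odd and `0` for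
`l` even. -/
theorem stmt_16 (G : Type) [Group G] [Finite G] (p : ℕ) [hp : Fact p.Prime]
    (hpG : p ∣ Nat.card G) (hp2 : ¬ p ^ 2 ∣ Nat.card G) (H J : Subgroup G)
    (hHJ : ¬ IsConjSubgroup H J) (hOp : IsConjSubgroup (Op p H) (Op p J))
    (l : ℕ) (hl : 1 ≤ l) :
    (Odd l → AddCommGroup.primaryComponent
        (((Ext (burnsideRing G) (ModuleCat (burnsideRing G)) l).obj
          (Opposite.op (ZB G H))).obj (ZB G H)) p = ⊥) ∧
    (Even l → Nonempty ((AddCommGroup.primaryComponent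
        (((Ext (burnsideRing G) (ModuleCat (burnsideRing G)) l).obj
          (Opposite.op (ZB G H))).obj (ZB G H)) p) ≃+ ZMod p)) ∧
    (Odd l → Nonempty ((AddCommGroup.primaryComponent
        (((Ext (burnsideRing G) (ModuleCat (burnsideRing G)) l).obj
          (Opposite.op (ZB G H))).obj (ZB G J)) p) ≃+ ZMod p)) ∧
    (Even l → AddCommGroup.primaryComponent
        (((Ext (burnsideRing G) (ModuleCat (burnsideRing G)) l).obj
          (Opposite.op (ZB G H))).obj (ZB G J)) p = ⊥) := by
  obtain ⟨n, rfl⟩ := Nat.exists_eq_add_of_le' hl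
  have hOp' : MarkCongr p H J :=
    (markCongr_op p H).symm.trans ((hOp.markCongr p).trans (markCongr_op p J))
  obtain ⟨s, hs⟩ := linked_markHom hpG hp2 hHJ hOp'
  have hs0 : s ≠ 0 := by
    rintro rfl
    exact hp.out.ne_one ((Nat.coprime_zero_left p).mp hs.coprime)
  obtain ⟨h₁, h₂, h₃, h₄⟩ := hs.primaryComponent_ext n hs0
  have transfer : ∀ X Y : ModuleCat.{0} (burnsideRing G),
      Nonempty (AddCommGroup.primaryComponent (((Ext (burnsideRing G)
        (ModuleCat.{0} (burnsideRing G)) (n + 1)).obj (Opposite.op X)).obj Y) p ≃+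
        AddCommGroup.primaryComponent (Abelian.Ext X Y (n + 1)) p) := fun X Y => by
    obtain ⟨e⟩ := nonempty_ext_addEquiv_abelianExt X Y n
    exact nonempty_primaryComponent_addEquiv (Nat.coprime_one_left p) e.toAddMonoidHom
      e.symm.toAddMonoidHom (fun x => by simp) (fun x => by simp)
  obtain ⟨e₁⟩ := transfer (ZB G H) (ZB G H)
  obtain ⟨e₂⟩ := transfer (ZB G H) (ZB G J)
  exact ⟨fun hn => primaryComponent_eq_bot_of_addEquiv e₁ (h₁ hn), fun hn => (h₂ hn).map e₁.trans,
    fun hn => (h₃ hn).map e₂.trans, fun hn => primaryComponent_eq_bot_of_addEquiv e₂ (h₄ hn)⟩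
end
end

section
/- Let G be a finite group whose order is not square-free. Then there exist subgroups H, J ≤ G such that the sequence of ranks of the finite abelian groups Ext^l_{A(G)}(ℤ_H, ℤ_J), l ≥ 1, is unbounded (where the rank of a finite abelian group is the minimal number of cyclic summands in a direct sum decomposition). -/
set_option synthInstance.maxHeartbeats 400000
set_option maxHeartbeats 1000000

noncomputable section

open CategoryTheory

/-- The rank of a finite abelian group: the minimal number of cyclic summands in a direct sum
decomposition into cyclic groups. -/
def abRank (A : Type*) [AddCommGroup A] : ℕ :=
  sInf {n : ℕ | ∃ d : Fin n → ℕ, Nonempty (A ≃+ ((i : Fin n) → ZMod (d i)))}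

/-- In positive degrees, the derived-functor `Ext` agrees with the `Ext` of the derived category. -/
theorem nonempty_ext_addEquiv {R : Type} [CommRing R] (X Y : ModuleCat.{0} R) (n : ℕ) :
    Nonempty ((((_root_.Ext R (ModuleCat R) (n + 1)).obj (Opposite.op X)).obj Y) ≃+
      Abelian.Ext X Y (n + 1)) := by
  let P := projectiveResolution X
  let K := P.complex.linearYonedaObj R Y
  let S := K.sc' n (n + 1) (n + 2)
  let e : ((((_root_.Ext R (ModuleCat R) (n + 1)).obj (Opposite.op X)).obj Y)) ≅
      S.moduleCatLeftHomologyData.H :=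
    P.isoExt (n + 1) Y ≪≫
      ShortComplex.homologyMapIso (K.isoSc' n (n + 1) (n + 2) (by simp) (by simp)) ≪≫
      S.moduleCatHomologyIso
  have hker : ∀ f : LinearMap.ker S.g.hom,
      P.complex.d (n + 2) (n + 1) ≫ (show P.complex.X (n + 1) ⟶ Y from f.1) = 0 := fun f => f.2
  let φ : LinearMap.ker S.g.hom →+ Abelian.Ext X Y (n + 1) :=
    AddMonoidHom.mk'
      (fun f => P.extMk (show P.complex.X (n + 1) ⟶ Y from f.1) (n + 2) rfl (hker f))
      (fun f g => (P.add_extMk _ _ _ _ _ _).symm)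
  have hφ : Function.Surjective φ := fun α => by
    obtain ⟨f, hf, rfl⟩ := P.extMk_surjective α (n + 2) rfl
    exact ⟨⟨f, hf⟩, rfl⟩
  have hφk : φ.ker = (LinearMap.range S.moduleCatToCycles).toAddSubgroup := by
    ext f
    rw [AddMonoidHom.mem_ker]
    refine (P.extMk_eq_zero_iff _ (n + 2) rfl (hker f) n rfl).trans ?_
    constructor
    · rintro ⟨g, hg⟩
      exact ⟨g, Subtype.ext hg⟩
    · rintro ⟨g, hg⟩
      exact ⟨g, congrArg Subtype.val hg⟩
  exact ⟨e.toLinearEquiv.toAddEquiv.trans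
    ((QuotientAddGroup.quotientAddEquivOfEq hφk.symm).trans
      (QuotientAddGroup.quotientKerEquivOfSurjective φ hφ))⟩

section Cardinality

variable {A B C : Type*} [AddCommGroup A] [AddCommGroup B] [AddCommGroup C]

lemma AddMonoidHom.enatCard_ker_mul_enatCard_range (g : B →+ C) :
    ENat.card g.ker * ENat.card g.range = ENat.card B := by
  rw [← ENat.card_prod]
  refine (ENat.card_congr ?_).symm
  exact (AddSubgroup.addGroupEquivQuotientProdAddSubgroup (s := g.ker)).trans
    ((Equiv.prodComm _ _).trans (Equiv.prodCongr (Equiv.refl _)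
      (QuotientAddGroup.quotientKerEquivRange g).toEquiv))

lemma ENat.card_le_mul_of_ker_le_range (f : A →+ B) (g : B →+ C)
    (h : ∀ b, g b = 0 → ∃ a, f a = b) : ENat.card B ≤ ENat.card A * ENat.card C := by
  rw [← g.enatCard_ker_mul_enatCard_range]
  refine mul_le_mul' ?_ (ENat.card_le_card_of_injective g.range.subtype_injective)
  choose s hs using h
  exact ENat.card_le_card_of_injective (f := fun b : g.ker => s b.1 b.2)
    fun b b' hbb => Subtype.ext <| by rw [← hs b.1 b.2, ← hs b'.1 b'.2]; exact congrArg f hbb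

lemma ENat.card_mul_le_of_comp_eq_zero (f : A →+ B) (g : B →+ C) (hf : Function.Injective f)
    (hg : Function.Surjective g) (h : ∀ a, g (f a) = 0) :
    ENat.card A * ENat.card C ≤ ENat.card B := by
  rw [← g.enatCard_ker_mul_enatCard_range]
  refine mul_le_mul' ?_ ?_
  · exact ENat.card_le_card_of_injective (f := fun a : A => (⟨f a, h a⟩ : g.ker))
      fun a a' haa => hf (congrArg Subtype.val haa)
  · rw [AddMonoidHom.range_eq_top.2 hg]
    exact ENat.card_le_card_of_injective (f := fun c : C => (⟨c, trivial⟩ : (⊤ : AddSubgroup C)))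
      fun a a' haa => congrArg Subtype.val haa

lemma ENat.card_range_le_pow {p n : ℕ} (d : Fin n → ℕ)
    (e : A ≃+ ((i : Fin n) → ZMod (d i))) (f : A →+ B) (hf : ∀ a, p • f a = 0) (hp : p ≠ 0) :
    ENat.card f.range ≤ (p ^ n : ℕ) := by
  have : NeZero p := ⟨hp⟩
  let u : (Fin n → Fin p) → B := fun v => f (e.symm fun i => ((v i : ℕ) : ZMod (d i)))
  have hu : ∀ b : f.range, ∃ v, u v = b := by
    rintro ⟨_, a, rfl⟩
    choose z hz using fun i => ZMod.intCast_surjective (e a i)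
    refine ⟨fun i => ⟨(z i % p).toNat, ?_⟩, ?_⟩
    · have h1 := Int.emod_nonneg (z i) (b := p) (by exact_mod_cast hp)
      have h2 := Int.emod_lt_of_pos (z i) (b := p) (by positivity)
      omega
    · have key : a = e.symm (fun i => (((z i % p).toNat : ℕ) : ZMod (d i))) +
          p • e.symm (fun i => ((z i / p : ℤ) : ZMod (d i))) := by
        apply e.injective
        rw [map_add, map_nsmul, e.apply_symm_apply, e.apply_symm_apply]
        funext i
        rw [← hz i]
        change _ = (((z i % p).toNat : ℕ) : ZMod (d i)) + p • ((z i / p : ℤ) : ZMod (d i))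
        rw [nsmul_eq_mul]
        have h1 : (((z i % p).toNat : ℕ) : ℤ) = z i % p :=
          Int.toNat_of_nonneg (Int.emod_nonneg (z i) (b := p) (by exact_mod_cast hp))
        rw [← Int.cast_natCast (R := ZMod (d i)), h1, ← Int.cast_natCast (R := ZMod (d i)) p,
          ← Int.cast_mul, ← Int.cast_add, Int.emod_add_mul_ediv]
      change _ = f a
      conv_rhs => rw [key, map_add, map_nsmul, hf, add_zero]
  choose v hv using hu
  calc ENat.card f.range ≤ ENat.card (Fin n → Fin p) :=
        ENat.card_le_card_of_injective (f := v) fun b b' hbb =>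
          Subtype.ext <| by rw [← hv b, ← hv b', hbb]
    _ = (p ^ n : ℕ) := by simp

lemma ZMod.enatCard_torsion_le (d p : ℕ) (hp : 0 < p) :
    ENat.card {x : ZMod d // p • x = 0} ≤ p := by
  rcases eq_or_ne d 0 with rfl | hd
  · have : Subsingleton {x : ZMod 0 // p • x = 0} := ⟨fun x y => Subtype.ext <| by
      have hx : (p • (x.1 : ℤ)) = 0 := x.2
      have hy : (p • (y.1 : ℤ)) = 0 := y.2
      simp only [smul_eq_zero, hp.ne', false_or] at hx hy
      exact hx.trans hy.symm⟩
    exact (ENat.card_le_one_iff_subsingleton _).2 this |>.trans (by exact_mod_cast hp)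
  · have : NeZero d := ⟨hd⟩
    have h := IsAddCyclic.card_nsmul_eq_zero_le (α := ZMod d) hp
    rw [ENat.card_eq_coe_fintype_card, Fintype.card_subtype]
    exact_mod_cast h

lemma ENat.card_range_torsion_le_pow {p n : ℕ} (d : Fin n → ℕ)
    (e : A ≃+ ((i : Fin n) → ZMod (d i))) (f : B →+ A) (hf : ∀ b, p • f b = 0) (hp : p ≠ 0) :
    ENat.card f.range ≤ (p ^ n : ℕ) := by
  have hfin : ∀ i, Finite {x : ZMod (d i) // p • x = 0} := fun i =>
    ENat.card_lt_top.1 ((ZMod.enatCard_torsion_le (d i) p (Nat.pos_of_ne_zero hp)).trans_lt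
      (ENat.natCast_lt_top p))
  have hf' : ∀ a : f.range, ∀ i, p • e a.1 i = 0 := by
    rintro ⟨_, b, rfl⟩ i
    rw [← Pi.smul_apply, ← map_nsmul, hf, map_zero, Pi.zero_apply]
  calc ENat.card f.range ≤ ENat.card ((i : Fin n) → {x : ZMod (d i) // p • x = 0}) :=
        ENat.card_le_card_of_injective (f := fun a i => ⟨e a.1 i, hf' a i⟩) fun a a' haa =>
          Subtype.ext <| e.injective <| funext fun i => congrArg Subtype.val (congrFun haa i)
    _ ≤ (p ^ n : ℕ) := by
        rw [ENat.card_eq_coe_natCard, Nat.card_pi]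
        refine Nat.cast_le.2 ((Finset.prod_le_pow_card _ _ p fun i _ => ?_).trans (by simp))
        have := ZMod.enatCard_torsion_le (d i) p (Nat.pos_of_ne_zero hp)
        rwa [ENat.card_eq_coe_natCard, Nat.cast_le] at this

lemma exists_addEquiv_of_abRank [AddGroup.FG A] :
    ∃ d : Fin (abRank A) → ℕ, Nonempty (A ≃+ ((i : Fin (abRank A)) → ZMod (d i))) := by
  refine Nat.sInf_mem (s := {n : ℕ | ∃ d : Fin n → ℕ,
    Nonempty (A ≃+ ((i : Fin n) → ZMod (d i)))}) ?_
  obtain ⟨n, ι, _, q, _, e, ⟨E⟩⟩ := AddCommGroup.equiv_free_prod_directSum_zmod A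
  classical
  let d : Fin n ⊕ ι → ℕ := Sum.elim (fun _ => 0) fun i => q i ^ e i
  let σ := Fintype.equivFin (Fin n ⊕ ι)
  refine ⟨Fintype.card (Fin n ⊕ ι), fun i => d (σ.symm i), ⟨E.trans ?_⟩⟩
  have E₁ : (Fin n →₀ ℤ) ≃+ ((i : Fin n) → ZMod (d (Sum.inl i))) :=
    (Finsupp.linearEquivFunOnFinite ℤ ℤ (Fin n)).toAddEquiv
  have E₂ : (DirectSum ι fun i => ZMod (q i ^ e i)) ≃+ ((i : ι) → ZMod (d (Sum.inr i))) :=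
    DirectSum.addEquivProd _
  refine (E₁.prodCongr E₂).trans ?_
  exact
    { (Equiv.sumPiEquivProdPi fun i => ZMod (d i)).symm.trans
        (Equiv.piCongrLeft' (fun i => ZMod (d i)) σ) with
      map_add' := fun x y => by
        funext i
        change ((Equiv.sumPiEquivProdPi fun i => ZMod (d i)).symm (x + y)) (σ.symm i) =
          ((Equiv.sumPiEquivProdPi fun i => ZMod (d i)).symm x) (σ.symm i) +
          ((Equiv.sumPiEquivProdPi fun i => ZMod (d i)).symm y) (σ.symm i)
        generalize σ.symm i = j
        cases j <;> rfl }

end Cardinality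

lemma abRank_congr {A B : Type*} [AddCommGroup A] [AddCommGroup B] (e : A ≃+ B) :
    abRank A = abRank B := by
  refine congrArg sInf (Set.ext fun n => exists_congr fun d => ?_)
  exact ⟨fun ⟨f⟩ => ⟨e.symm.trans f⟩, fun ⟨f⟩ => ⟨e.trans f⟩⟩

namespace CategoryTheory.Abelian.Ext

universe w v u

variable {C : Type u} [Category.{v} C] [Abelian C] [HasExt.{w} C]

lemma mk₀_zsmul_id_comp {X Y : C} {n : ℕ} (c : ℤ) (x : Ext X Y n) :
    (mk₀ (c • 𝟙 X)).comp x (zero_add n) = c • x := by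
  let φ : (X ⟶ X) →+ Ext X Y n :=
    AddMonoidHom.mk' (fun f => (mk₀ f).comp x (zero_add n)) fun f g => by
      rw [mk₀_add, add_comp]
  change φ (c • 𝟙 X) = _
  rw [map_zsmul]
  exact congrArg (c • ·) (mk₀_id_comp x)

lemma comp_mk₀_zsmul_id {X Y : C} {n : ℕ} (c : ℤ) (x : Ext X Y n) :
    x.comp (mk₀ (c • 𝟙 Y)) (add_zero n) = c • x := by
  let φ : (Y ⟶ Y) →+ Ext X Y n :=
    AddMonoidHom.mk' (fun f => x.comp (mk₀ f) (add_zero n)) fun f g => by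
      rw [mk₀_add, comp_add]
  change φ (c • 𝟙 Y) = _
  rw [map_zsmul]
  exact congrArg (c • ·) (comp_mk₀_id x)

lemma zsmul_eq_zero_of_zsmul_id {X Y : C} {n : ℕ} {p : ℤ} (hp : p • 𝟙 Y = 0) (x : Ext X Y n) :
    p • x = 0 := by
  rw [← comp_mk₀_zsmul_id, hp, mk₀_zero, comp_zero]

lemma eq_zero_of_zsmul_eq_zero {X Y : C} {n : ℕ} {p c : ℤ} (hp : p • 𝟙 Y = 0)
    (hc : IsCoprime c p) {x : Ext X Y n} (hx : c • x = 0) : x = 0 := by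
  obtain ⟨a, b, h⟩ := hc
  rw [← one_zsmul x, ← h, add_zsmul, mul_zsmul, mul_zsmul, hx, zsmul_eq_zero_of_zsmul_id hp,
    zsmul_zero, zsmul_zero, add_zero]

lemma card_mul_le_of_decomposition {X Z W Y : C} {p c : ℤ} (hp : p • 𝟙 Y = 0)
    (hc : IsCoprime c p) (i : Z ⟶ X) (r : X ⟶ Z) (j : W ⟶ X) (q : X ⟶ W)
    (hir : i ≫ r = c • 𝟙 Z) (hjq : j ≫ q = c • 𝟙 W) (hiq : i ≫ q = 0) (hjr : j ≫ r = 0) (n : ℕ) :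
    ENat.card (Ext Z Y n) * ENat.card (Ext W Y n) ≤ ENat.card (Ext X Y n) := by
  rw [← ENat.card_prod]
  let φ : Ext Z Y n × Ext W Y n →+ Ext X Y n :=
    AddMonoidHom.mk' (fun x => (mk₀ r).comp x.1 (zero_add n) + (mk₀ q).comp x.2 (zero_add n))
      fun x y => by
        rw [Prod.fst_add, Prod.snd_add, comp_add, comp_add]
        abel
  refine ENat.card_le_card_of_injective (f := φ) ((injective_iff_map_eq_zero φ).2 ?_)
  rintro ⟨x, y⟩ h
  have h' : (mk₀ r).comp x (zero_add n) + (mk₀ q).comp y (zero_add n) = 0 := h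
  have h₁ := congrArg (fun z => (mk₀ i).comp z (zero_add n)) h'
  have h₂ := congrArg (fun z => (mk₀ j).comp z (zero_add n)) h'
  simp only [comp_add, mk₀_comp_mk₀_assoc, hir, hjq, hiq, hjr, mk₀_zero, zero_comp, comp_zero,
    add_zero, zero_add, mk₀_zsmul_id_comp] at h₁ h₂
  exact Prod.ext (eq_zero_of_zsmul_eq_zero hp hc h₁) (eq_zero_of_zsmul_eq_zero hp hc h₂)

lemma card_le_of_retract {X Z Y : C} {p c : ℤ} (hp : p • 𝟙 Y = 0)
    (hc : IsCoprime c p) (i : Z ⟶ X) (r : X ⟶ Z) (hir : i ≫ r = c • 𝟙 Z) (n : ℕ) :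
    ENat.card (Ext Z Y n) ≤ ENat.card (Ext X Y n) := by
  refine ENat.card_le_card_of_injective (f := (mk₀ r).precomp Y (zero_add n))
    ((injective_iff_map_eq_zero _).2 fun x h => ?_)
  have h₁ := congrArg (fun z => (mk₀ i).comp z (zero_add n))
    (show (mk₀ r).comp x (zero_add n) = 0 from h)
  simp only [mk₀_comp_mk₀_assoc, hir, comp_zero, mk₀_zsmul_id_comp] at h₁
  exact eq_zero_of_zsmul_eq_zero hp hc h₁

lemma card_le_card_succ_of_projective {S : ShortComplex C} (hS : S.ShortExact) [Projective S.X₂]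
    (Y : C) (n : ℕ) : ENat.card (Ext S.X₁ Y (n + 1)) ≤ ENat.card (Ext S.X₃ Y (n + 2)) := by
  refine ENat.card_le_card_of_injective
    (f := hS.extClass.precomp Y (by omega : 1 + (n + 1) = n + 2))
    ((injective_iff_map_eq_zero _).2 fun x h => ?_)
  obtain ⟨y, rfl⟩ := contravariant_sequence_exact₁ hS Y x (by omega) h
  rw [eq_zero_of_projective y, comp_zero]

lemma card_succ_le_mul {S : ShortComplex C} (hS : S.ShortExact) (Y : C) (n : ℕ) :
    ENat.card (Ext S.X₃ Y (n + 1)) ≤ ENat.card (Ext S.X₁ Y n) * ENat.card (Ext S.X₂ Y (n + 1)) :=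
  ENat.card_le_mul_of_ker_le_range (hS.extClass.precomp Y (by omega : 1 + n = n + 1))
    ((mk₀ S.g).precomp Y (zero_add (n + 1)))
    fun x hx => contravariant_sequence_exact₃ hS Y x hx (by omega)

lemma card_mul_le_card_succ {S : ShortComplex C} (hS : S.ShortExact) {Y : C} {n : ℕ}
    (h₀ : ∀ x : Ext S.X₂ Y n, (mk₀ S.f).comp x (zero_add n) = 0)
    (h₁ : ∀ x : Ext S.X₂ Y (n + 1), (mk₀ S.f).comp x (zero_add (n + 1)) = 0) :
    ENat.card (Ext S.X₁ Y n) * ENat.card (Ext S.X₂ Y (n + 1)) ≤ ENat.card (Ext S.X₃ Y (n + 1)) :=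
  ENat.card_mul_le_of_comp_eq_zero (hS.extClass.precomp Y (by omega : 1 + n = n + 1))
    ((mk₀ S.g).precomp Y (zero_add (n + 1)))
    ((injective_iff_map_eq_zero _).2 fun x h => by
      obtain ⟨y, rfl⟩ := contravariant_sequence_exact₁ hS Y x (by omega) h
      exact h₀ y)
    (fun x => contravariant_sequence_exact₂ hS Y x (h₁ x))
    fun x => by
      change (mk₀ S.g).comp (hS.extClass.comp x (by omega : 1 + n = n + 1)) (zero_add (n + 1)) = 0
      rw [← comp_assoc (mk₀ S.g) hS.extClass x (zero_add 1) (by omega) (by omega),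
        hS.comp_extClass, zero_comp]

lemma card_le_pow_abRank {S : ShortComplex C} (hS : S.ShortExact) {p : ℕ} (hp₀ : p ≠ 0)
    (hp : (p : ℤ) • 𝟙 S.X₃ = 0) (X : C) (n : ℕ) [AddGroup.FG (Ext X S.X₂ n)]
    [AddGroup.FG (Ext X S.X₁ (n + 1))] :
    ENat.card (Ext X S.X₃ n) ≤
      (p ^ abRank (Ext X S.X₂ n) : ℕ) * (p ^ abRank (Ext X S.X₁ (n + 1)) : ℕ) := by
  obtain ⟨d₂, ⟨e₂⟩⟩ := exists_addEquiv_of_abRank (A := Ext X S.X₂ n)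
  obtain ⟨d₁, ⟨e₁⟩⟩ := exists_addEquiv_of_abRank (A := Ext X S.X₁ (n + 1))
  let φ := (mk₀ S.g).postcomp X (add_zero n)
  let ψ := hS.extClass.postcomp X (rfl : n + 1 = n + 1)
  have hx : ∀ x : Ext X S.X₃ n, p • x = 0 := fun x => by
    rw [← natCast_zsmul, zsmul_eq_zero_of_zsmul_id hp]
  calc ENat.card (Ext X S.X₃ n) ≤ ENat.card φ.range * ENat.card ψ.range :=
        ENat.card_le_mul_of_ker_le_range φ.range.subtype ψ.rangeRestrict fun x h => by
          obtain ⟨y, hy⟩ := covariant_sequence_exact₃ X hS x rfl (congrArg Subtype.val h)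
          exact ⟨⟨x, y, hy⟩, rfl⟩
    _ ≤ _ := mul_le_mul'
        (ENat.card_range_le_pow d₂ e₂ φ
          (fun x => by rw [← map_nsmul, ← hx (φ x), map_nsmul]) hp₀)
        (ENat.card_range_torsion_le_pow d₁ e₁ ψ (fun x => by rw [← map_nsmul, hx, map_zero]) hp₀)

end CategoryTheory.Abelian.Ext

/-- The additive group of `S`, regarded as an `R`-module along a ring homomorphism `R → S`. -/
def Via {R S : Type} [CommRing R] [CommRing S] (_χ : R →+* S) : Type := S

namespace Via

section

variable {R S M : Type} [CommRing R] [CommRing S] [AddCommGroup M] [Module R M] (χ : R →+* S)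

instance : AddCommGroup (Via χ) := inferInstanceAs (AddCommGroup S)

instance : Module R (Via χ) := Module.compHom S χ

/-- An `R`-linear map into `Via χ`, given by an additive map that is semilinear along `χ`. -/
def lift (f : M →+ S) (hf : ∀ a m, f (a • m) = χ a * f m) : M →ₗ[R] Via χ where
  toFun := f
  map_add' := f.map_add
  map_smul' := hf

/-- An `R`-linear map out of `Via χ`. -/
def desc (f : S →+ M) (hf : ∀ a x, f (χ a * x) = a • f x) : Via χ →ₗ[R] M where
  toFun := f
  map_add' := f.map_add
  map_smul' := hf

/-- The `R`-linear map `R → Via χ` given by `χ` itself. -/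
def aug : R →ₗ[R] Via χ := lift χ χ.toAddMonoidHom fun a m => χ.map_mul a m

end

section

variable {R : Type} [CommRing R] (χ : R →+* ℤ)

lemma aug_surjective : Function.Surjective (aug χ) := fun n =>
  ⟨((show ℤ from n) : R), map_intCast χ _⟩

instance : Module.Finite R (Via χ) := Module.Finite.of_surjective _ (aug_surjective χ)

variable {p : ℕ} (κ : R →+* ZMod p)

lemma zsmul_id_eq_zero : (p : ℤ) • 𝟙 (ModuleCat.of R (Via κ)) = 0 := by
  ext x
  have h : ∀ x : ZMod p, (p : ℤ) • x = 0 := by simp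
  exact h x

lemma dvd_of_eq_zero (hκ : ∀ a, ((χ a : ℤ) : ZMod p) = κ a) {χ' : R →+* ℤ}
    (hκ' : ∀ a, ((χ' a : ℤ) : ZMod p) = κ a) {a : R} (ha : χ a = 0) : (p : ℤ) ∣ χ' a := by
  rw [← ZMod.intCast_zmod_eq_zero_iff_dvd, hκ', ← hκ, ha, Int.cast_zero]

/-- Division by `p` of an additive map all of whose values are divisible by `p`. -/
def divHom {M : Type} [AddCommGroup M] (p : ℕ) (f : M →+ ℤ) (h : ∀ m, (p : ℤ) ∣ f m) : M →+ ℤ :=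
  AddMonoidHom.mk' (fun m => f m / p) fun a b => by
    rw [map_add, Int.add_ediv_of_dvd_left (h a)]

/-- The complex `ℤ → ℤ → ℤ/p` of multiplication by `p` and reduction, with `R` acting via `χ`. -/
def reduction (hκ : ∀ a, ((χ a : ℤ) : ZMod p) = κ a) : ShortComplex (ModuleCat.{0} R) where
  X₁ := ModuleCat.of R (Via χ)
  X₂ := ModuleCat.of R (Via χ)
  X₃ := ModuleCat.of R (Via κ)
  f := (p : ℤ) • 𝟙 _
  g := ModuleCat.ofHom (lift κ (Int.castAddHom (ZMod p)) fun a m => by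
    change ((χ a * (show ℤ from m) : ℤ) : ZMod p) = κ a * ((show ℤ from m : ℤ) : ZMod p)
    rw [Int.cast_mul, hκ])
  zero := by
    ext x
    have h : ∀ x : ℤ, (((p : ℤ) • x : ℤ) : ZMod p) = 0 := by simp
    exact h x

lemma reduction_shortExact (hκ : ∀ a, ((χ a : ℤ) : ZMod p) = κ a)
    (hp : p ≠ 0) : (reduction χ κ hκ).ShortExact := by
  refine ModuleCat.shortComplex_shortExact _ ?_ ?_ ?_
  · intro y
    change ((show ℤ from y : ℤ) : ZMod p) = 0 ↔ ∃ x : ℤ, (p : ℤ) • x = y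
    rw [ZMod.intCast_zmod_eq_zero_iff_dvd]
    exact exists_congr fun x => eq_comm
  · intro x y h
    change (p : ℤ) • (show ℤ from x) = (p : ℤ) • (show ℤ from y) at h
    exact smul_right_injective ℤ (by exact_mod_cast hp) h
  · exact ZMod.intCast_surjective

open Abelian.Ext in
lemma card_ext_residue (hκ : ∀ a, ((χ a : ℤ) : ZMod p) = κ a)
    (hp : p ≠ 0) {Y : ModuleCat.{0} R} (hY : (p : ℤ) • 𝟙 Y = 0) (n : ℕ) :
    ENat.card (Abelian.Ext (ModuleCat.of R (Via κ)) Y (n + 1)) =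
      ENat.card (Abelian.Ext (ModuleCat.of R (Via χ)) Y n) *
        ENat.card (Abelian.Ext (ModuleCat.of R (Via χ)) Y (n + 1)) := by
  have hS := reduction_shortExact χ κ hκ hp
  refine le_antisymm (card_succ_le_mul hS Y n) (card_mul_le_card_succ hS ?_ ?_) <;>
  · intro x
    exact (mk₀_zsmul_id_comp (p : ℤ) x).trans (zsmul_eq_zero_of_zsmul_id hY x)

end

section

open Abelian.Ext

variable {R : Type} [CommRing R] (χ₀ χ₁ χ₂ : R →+* ℤ) {p : ℕ} (κ : R →+* ZMod p)

/-- The additive map `m ↦ χ₁ (f m) / p` for a linear map `f : M → R` all of whose values have `χ₁`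
divisible by `p`. -/
def divLift {M : Type} [AddCommGroup M] [Module R M] (p : ℕ) (f : M →ₗ[R] R)
    (h : ∀ m, (p : ℤ) ∣ χ₁ (f m)) : M →ₗ[R] Via χ₁ :=
  lift χ₁ (divHom p (χ₁.toAddMonoidHom.comp f.toAddMonoidHom) h) fun a m => by
    change χ₁ (f (a • m)) / p = χ₁ a * (χ₁ (f m) / p)
    rw [map_smul, smul_eq_mul, map_mul, Int.mul_ediv_assoc _ (h m)]

/-- The linear map `n ↦ n s` for an element `s` on which `R` acts via `χ₁`. -/
def mulElem {s : R} (hs : ∀ a : R, a * s = (χ₁ a : R) * s) : Via χ₁ →ₗ[R] R :=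
  desc χ₁ ((AddMonoidHom.mulRight s).comp (Int.castAddHom R)) fun a n => by
    change ((χ₁ a * n : ℤ) : R) * s = a * ((n : R) * s)
    rw [Int.cast_mul, mul_left_comm a (n : R) s, hs a]
    ring

/-- The common kernel of two ring homomorphisms to `ℤ`. -/
abbrev commonKer : Submodule R R := LinearMap.ker (aug χ₀) ⊓ LinearMap.ker (aug χ₁)

lemma card_mul_le_card_ker (hκ₀ : ∀ a, ((χ₀ a : ℤ) : ZMod p) = κ a)
    (hκ₁ : ∀ a, ((χ₁ a : ℤ) : ZMod p) = κ a) (hp : p ≠ 0) {c : ℤ} (hc : IsCoprime c p) {s : R}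
    (hs : ∀ a : R, a * s = (χ₁ a : R) * s) (hs₀ : χ₀ s = 0) (hs₁ : χ₁ s = p * c)
    {Y : ModuleCat.{0} R} (hY : (p : ℤ) • 𝟙 Y = 0) (n : ℕ) :
    ENat.card (Abelian.Ext (ModuleCat.of R (Via χ₁)) Y n) *
        ENat.card (Abelian.Ext (ModuleCat.of R (commonKer χ₀ χ₁)) Y n) ≤
      ENat.card (Abelian.Ext (ModuleCat.of R (LinearMap.ker (aug χ₀))) Y n) := by
  have hp' : (p : ℤ) ≠ 0 := by exact_mod_cast hp
  have hdvd : ∀ a : LinearMap.ker (aug χ₀), (p : ℤ) ∣ χ₁ a.1 := fun a =>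
    dvd_of_eq_zero χ₀ κ hκ₀ hκ₁ a.2
  let i : Via χ₁ →ₗ[R] LinearMap.ker (aug χ₀) := (mulElem χ₁ hs).codRestrict _ fun n => by
    change χ₀ ((((show ℤ from n) : ℤ) : R) * s) = 0
    rw [map_mul, hs₀, mul_zero]
  let r : LinearMap.ker (aug χ₀) →ₗ[R] Via χ₁ :=
    divLift χ₁ p (LinearMap.ker (aug χ₀)).subtype hdvd
  let j : commonKer χ₀ χ₁ →ₗ[R] LinearMap.ker (aug χ₀) := Submodule.inclusion inf_le_left
  have hi : ∀ n : ℤ, (i n).1 = (n : R) * s := fun n => rfl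
  have hr : ∀ a, r a = (χ₁ a.1 / p : ℤ) := fun a => rfl
  let q : LinearMap.ker (aug χ₀) →ₗ[R] commonKer χ₀ χ₁ :=
    (c • (LinearMap.ker (aug χ₀)).subtype - (mulElem χ₁ hs).comp r).codRestrict _ fun a => by
      change χ₀ (c • a.1 - ((χ₁ a.1 / p : ℤ) : R) * s) = 0 ∧
        χ₁ (c • a.1 - ((χ₁ a.1 / p : ℤ) : R) * s) = 0
      have ha : χ₀ a.1 = 0 := a.2
      obtain ⟨t, ht⟩ := hdvd a
      rw [ht, Int.mul_ediv_cancel_left _ hp', map_sub, map_sub, map_mul, map_mul, hs₀, hs₁,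
        map_zsmul, map_zsmul, ha, ht, map_intCast χ₁, Int.cast_id]
      constructor
      · simp
      · rw [smul_eq_mul]
        ring
  have hq : ∀ a, (q a).1 = c • a.1 - ((χ₁ a.1 / p : ℤ) : R) * s := fun a => rfl
  have hri : ∀ n : ℤ, r (i n) = (c * n : ℤ) := fun n => by
    rw [hr, hi, map_mul, map_intCast, hs₁, Int.cast_id, mul_left_comm,
      Int.mul_ediv_cancel_left _ hp', mul_comm]
  refine card_mul_le_of_decomposition hY hc (ModuleCat.ofHom i) (ModuleCat.ofHom r)
    (ModuleCat.ofHom j) (ModuleCat.ofHom q) ?_ ?_ ?_ ?_ n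
  · exact ModuleCat.hom_ext (LinearMap.ext hri)
  · refine ModuleCat.hom_ext (LinearMap.ext fun a => ?_)
    refine Subtype.ext ((hq (j a)).trans ?_)
    change c • a.1 - ((χ₁ a.1 / p : ℤ) : R) * s = c • a.1
    rw [show χ₁ a.1 = 0 from a.2.2, Int.zero_ediv, Int.cast_zero, zero_mul, sub_zero]
  · refine ModuleCat.hom_ext (LinearMap.ext fun (n : ℤ) => ?_)
    refine Subtype.ext ((hq (i n)).trans ?_)
    have h : χ₁ (i n).1 / p = c * n := hri n
    rw [h, hi, Int.cast_mul, zsmul_eq_mul, mul_assoc]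
    exact sub_self _
  · ext a
    change (χ₁ a.1 / p : ℤ) = 0
    rw [show χ₁ a.1 = 0 from a.2.2, Int.zero_ediv]

lemma card_le_card_commonKer (hκ₁ : ∀ a, ((χ₁ a : ℤ) : ZMod p) = κ a)
    (hκ₂ : ∀ a, ((χ₂ a : ℤ) : ZMod p) = κ a) (hp : p ≠ 0) {c : ℤ} (hc : IsCoprime c p) {s : R}
    (hs : ∀ a : R, a * s = (χ₁ a : R) * s) (hs₁ : χ₁ s = p * c)
    {w : R} (hw : w ∈ commonKer χ₀ χ₁) (hw₂ : χ₂ w ≠ 0)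
    {Y : ModuleCat.{0} R} (hY : (p : ℤ) • 𝟙 Y = 0) (n : ℕ) :
    ENat.card (Abelian.Ext (ModuleCat.of R (Via χ₁)) Y (n + 1)) ≤
      ENat.card (Abelian.Ext (ModuleCat.of R (commonKer χ₀ χ₁)) Y (n + 2)) := by
  have hp' : (p : ℤ) ≠ 0 := by exact_mod_cast hp
  let W := commonKer χ₀ χ₁
  let f : W →ₗ[R] Via χ₂ := (aug χ₂).comp W.subtype
  let g : W →+ ℤ := χ₂.toAddMonoidHom.comp W.subtype.toAddMonoidHom
  obtain ⟨d, hd⟩ := Int.subgroup_cyclic g.range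
  have hfd : ∀ x : W, ∃ e : ℤ, e * d = χ₂ x.1 := fun x => by
    have : χ₂ x.1 ∈ g.range := ⟨x, rfl⟩
    rw [hd, AddSubgroup.mem_closure_singleton] at this
    simpa using this
  obtain ⟨w₁, hw₁⟩ : ∃ w₁ : W, χ₂ w₁.1 = d := by
    have : d ∈ g.range := by
      rw [hd]
      exact AddSubgroup.mem_closure_singleton_self d
    exact this
  have hd₀ : d ≠ 0 := fun h => by
    obtain ⟨e, he⟩ := hfd ⟨w, hw⟩
    rw [h, mul_zero] at he
    exact hw₂ he.symm
  let ψ : (LinearMap.ker f →₀ R) →ₗ[R] W := Finsupp.linearCombination R Subtype.val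
  let φ : R × (LinearMap.ker f →₀ R) →ₗ[R] W := (LinearMap.toSpanSingleton R W w₁).coprod ψ
  have hφ : ∀ a x, φ (a, x) = a • w₁ + ψ x := fun a x => rfl
  have hfψ : ∀ x, f (ψ x) = 0 := fun x => by
    rw [Finsupp.apply_linearCombination,
      show (f ∘ Subtype.val : LinearMap.ker f → Via χ₂) = 0 from funext fun y => y.2,
      Finsupp.linearCombination_zero, LinearMap.zero_apply]
  have hsurj : Function.Surjective φ := fun x => by
    obtain ⟨e, he⟩ := hfd x
    refine ⟨((e : R), Finsupp.single ⟨x - (e : R) • w₁, ?_⟩ 1), ?_⟩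
    · change χ₂ (x.1 - (e : R) * w₁.1) = 0
      rw [map_sub, map_mul, map_intCast, hw₁, ← he, Int.cast_id, sub_self]
    · rw [hφ, Finsupp.linearCombination_single, one_smul, add_sub_cancel]
  have hker : ∀ z : LinearMap.ker φ, χ₂ z.1.1 = 0 := fun z => by
    have h : f (φ (z.1.1, z.1.2)) = 0 := by
      rw [show φ (z.1.1, z.1.2) = 0 from z.2, map_zero]
    rw [hφ, map_add, hfψ, add_zero] at h
    have h' : χ₂ (z.1.1 * w₁.1) = 0 := h
    rw [map_mul, hw₁] at h'
    exact (mul_eq_zero.1 h').resolve_right hd₀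
  have hdvd : ∀ z : LinearMap.ker φ, (p : ℤ) ∣ χ₁ z.1.1 := fun z =>
    dvd_of_eq_zero χ₂ κ hκ₂ hκ₁ (hker z)
  let i : Via χ₁ →ₗ[R] LinearMap.ker φ :=
    ((LinearMap.inl R R (LinearMap.ker f →₀ R)).comp (mulElem χ₁ hs)).codRestrict _ fun n => by
      change ((((show ℤ from n) : ℤ) : R) * s) • w₁ + ψ 0 = 0
      rw [map_zero, add_zero]
      refine Subtype.ext ?_
      change ((((show ℤ from n) : ℤ) : R) * s) * w₁.1 = 0
      rw [mul_assoc, mul_comm s, hs, show χ₁ w₁.1 = 0 from w₁.2.2, Int.cast_zero, zero_mul,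
        mul_zero]
  let r : LinearMap.ker φ →ₗ[R] Via χ₁ :=
    divLift (M := LinearMap.ker φ) χ₁ p
      ((LinearMap.fst R R (LinearMap.ker f →₀ R)).comp (LinearMap.ker φ).subtype) hdvd
  have : Projective (φ.shortComplexKer).X₂ := by
    change Projective (ModuleCat.of R (R × (LinearMap.ker f →₀ R)))
    infer_instance
  refine le_trans (card_le_of_retract hY hc (ModuleCat.ofHom i) (ModuleCat.ofHom r) ?_ (n + 1))
    (card_le_card_succ_of_projective (LinearMap.shortExact_shortComplexKer hsurj) Y n)
  refine ModuleCat.hom_ext (LinearMap.ext fun (n : ℤ) => ?_)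
  change χ₁ ((n : R) * s) / p = c * n
  rw [map_mul, map_intCast, hs₁, Int.cast_id, mul_left_comm, Int.mul_ediv_cancel_left _ hp',
    mul_comm]

lemma two_le_card_ext_one (hκ₀ : ∀ a, ((χ₀ a : ℤ) : ZMod p) = κ a)
    (hκ₁ : ∀ a, ((χ₁ a : ℤ) : ZMod p) = κ a) (hp : p ≠ 0) {c : ℤ} (hpc : ¬ (p : ℤ) ∣ c) {s : R}
    (hs₀ : χ₀ s = 0) (hs₁ : χ₁ s = p * c) :
    2 ≤ ENat.card (Abelian.Ext (ModuleCat.of R (Via χ₀)) (ModuleCat.of R (Via κ)) 1) := by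
  have hp' : (p : ℤ) ≠ 0 := by exact_mod_cast hp
  have hdvd : ∀ a : LinearMap.ker (aug χ₀), (p : ℤ) ∣ χ₁ a.1 := fun a =>
    dvd_of_eq_zero χ₀ κ hκ₀ hκ₁ a.2
  have hS := LinearMap.shortExact_shortComplexKer (aug_surjective χ₀)
  let ρ : LinearMap.ker (aug χ₀) →ₗ[R] Via κ :=
    (reduction χ₁ κ hκ₁).g.hom.comp (divLift χ₁ p (LinearMap.ker (aug χ₀)).subtype hdvd)
  have hρ : ρ ⟨s, hs₀⟩ ≠ 0 := fun h => by
    have h' : ((χ₁ s / p : ℤ) : ZMod p) = 0 := h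
    rw [hs₁, Int.mul_ediv_cancel_left _ hp', ZMod.intCast_zmod_eq_zero_iff_dvd] at h'
    exact hpc h'
  have hne : hS.extClass.comp (mk₀ (ModuleCat.ofHom ρ)) (add_zero 1) ≠ 0 := fun h => by
    obtain ⟨y, hy⟩ := contravariant_sequence_exact₁ hS _ (mk₀ (ModuleCat.ofHom ρ)) (add_zero 1) h
    obtain ⟨g, rfl⟩ := (mk₀_bijective _ _).2 y
    rw [mk₀_comp_mk₀] at hy
    have hg := congrArg (fun u => u.hom ⟨s, hs₀⟩) ((mk₀_bijective _ _).1 hy)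
    have hg' : g.hom s = ρ ⟨s, hs₀⟩ := hg
    refine hρ (hg'.symm.trans ?_)
    have h₁ : g.hom (s • (1 : R)) = s • g.hom (1 : R) := map_smul g.hom s (1 : R)
    rw [smul_eq_mul, mul_one] at h₁
    refine h₁.trans ?_
    change κ s * (show ZMod p from g.hom (1 : R)) = 0
    rw [← hκ₀, hs₀, Int.cast_zero, zero_mul]
  have : Nontrivial (Abelian.Ext (ModuleCat.of R (Via χ₀)) (ModuleCat.of R (Via κ)) 1) :=
    ⟨_, _, hne⟩
  exact Order.add_one_le_of_lt ((ENat.one_lt_card_iff_nontrivial _).2 this)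

lemma card_ext_mul_le (hκ₀ : ∀ a, ((χ₀ a : ℤ) : ZMod p) = κ a)
    (hκ₁ : ∀ a, ((χ₁ a : ℤ) : ZMod p) = κ a) (hκ₂ : ∀ a, ((χ₂ a : ℤ) : ZMod p) = κ a)
    (hp : p ≠ 0) {c : ℤ} (hc : IsCoprime c p) {s : R}
    (hs : ∀ a : R, a * s = (χ₁ a : R) * s) (hs₀ : χ₀ s = 0) (hs₁ : χ₁ s = p * c)
    {w : R} (hw₀ : χ₀ w = 0) (hw₁ : χ₁ w = 0) (hw₂ : χ₂ w ≠ 0)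
    {Y : ModuleCat.{0} R} (hY : (p : ℤ) • 𝟙 Y = 0) (n : ℕ) :
    ENat.card (Abelian.Ext (ModuleCat.of R (Via χ₀)) Y (n + 1)) *
        ENat.card (Abelian.Ext (ModuleCat.of R (Via χ₀)) Y (n + 2)) ≤
      ENat.card (Abelian.Ext (ModuleCat.of R (Via χ₀)) Y (n + 3)) := by
  have hS := LinearMap.shortExact_shortComplexKer (aug_surjective χ₀)
  have : Projective (LinearMap.shortComplexKer (aug χ₀)).X₂ := by
    change Projective (ModuleCat.of R R)
    infer_instance
  rw [← card_ext_residue χ₀ κ hκ₀ hp hY, card_ext_residue χ₁ κ hκ₁ hp hY, mul_comm]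
  refine le_trans (mul_le_mul_right ?_ _)
    ((card_mul_le_card_ker χ₀ χ₁ κ hκ₀ hκ₁ hp hc hs hs₀ hs₁ hY (n + 2)).trans
      (card_le_card_succ_of_projective hS Y (n + 1)))
  exact card_le_card_commonKer χ₀ χ₁ χ₂ κ hκ₁ hκ₂ hp hc hs hs₁ ⟨hw₀, hw₁⟩ hw₂ hY n

lemma addGroupFG_of_finite (R M : Type*) [CommRing R] [AddCommGroup M] [Module R M]
    [Module.Finite ℤ R] [Module.Finite R M] : AddGroup.FG M :=
  Module.Finite.iff_addGroup_fg.1 (Module.Finite.trans R M)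

/-- Suppose that `χ₀`, `χ₁`, `χ₂` agree modulo `p`, that `χ₁` is split off up to `p` times a unit mod
`p` by an element `s`, and that `χ₂` differs from `χ₀` and `χ₁`.  Then the ranks of the groups
`Ext` from `ℤ` to `ℤ` along `χ₀` are unbounded. -/
theorem exists_lt_abRank_ext [IsNoetherianRing R] [Module.Finite ℤ R] [Fact p.Prime]
    (hκ₀ : ∀ a, ((χ₀ a : ℤ) : ZMod p) = κ a)
    (hκ₁ : ∀ a, ((χ₁ a : ℤ) : ZMod p) = κ a) (hκ₂ : ∀ a, ((χ₂ a : ℤ) : ZMod p) = κ a)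
    {c : ℤ} (hpc : ¬ (p : ℤ) ∣ c) {s : R}
    (hs : ∀ a : R, a * s = (χ₁ a : R) * s) (hs₀ : χ₀ s = 0) (hs₁ : χ₁ s = p * c)
    {w : R} (hw₀ : χ₀ w = 0) (hw₁ : χ₁ w = 0) (hw₂ : χ₂ w ≠ 0) (C : ℕ) :
    ∃ l : ℕ, 1 ≤ l ∧ C < abRank (((_root_.Ext R (ModuleCat R) l).obj
      (Opposite.op (ModuleCat.of R (Via χ₀)))).obj (ModuleCat.of R (Via χ₀))) := by
  by_contra! H
  have hp : p ≠ 0 := (Fact.out : p.Prime).ne_zero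
  have hc : IsCoprime c p :=
    ((Prime.coprime_iff_not_dvd (Nat.prime_iff_prime_int.1 Fact.out)).2 hpc).symm
  let b : ℕ → ℕ∞ := fun n =>
    ENat.card (Abelian.Ext (ModuleCat.of R (Via χ₀)) (ModuleCat.of R (Via κ)) n)
  have hb : ∀ n, 1 ≤ b n := fun n =>
    Order.one_le_iff_pos.2 ((ENat.card_pos_iff_nonempty _).2 ⟨0⟩)
  have hrec : ∀ n, b (n + 1) * b (n + 2) ≤ b (n + 3) := fun n =>
    card_ext_mul_le χ₀ χ₁ χ₂ κ hκ₀ hκ₁ hκ₂ hp hc hs hs₀ hs₁ hw₀ hw₁ hw₂ (zsmul_id_eq_zero κ) n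
  have h₂ : ∀ n, 2 ≤ b (n + 3) := fun n => by
    induction n with
    | zero =>
      exact (mul_le_mul' (two_le_card_ext_one χ₀ χ₁ κ hκ₀ hκ₁ hp hpc hs₀ hs₁) (hb 2)).trans
        (hrec 0)
    | succ n ih => exact (mul_le_mul' (hb (n + 2)) ih).trans (hrec (n + 1))
  have hpow : ∀ n, ((2 ^ n : ℕ) : ℕ∞) ≤ b (n + 4) := fun n => by
    induction n with
    | zero => exact hb 4
    | succ n ih =>
      rw [pow_succ', Nat.cast_mul]
      exact (mul_le_mul' (h₂ n) ih).trans (hrec (n + 2))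
  have hfg : ∀ n, AddGroup.FG (Abelian.Ext (ModuleCat.of R (Via χ₀)) (ModuleCat.of R (Via χ₀)) n) :=
    fun n => by
      have : Module.Finite R (ModuleCat.of R (Via χ₀)) := inferInstanceAs (Module.Finite R (Via χ₀))
      exact addGroupFG_of_finite R _
  have hle : ∀ n,
      abRank (Abelian.Ext (ModuleCat.of R (Via χ₀)) (ModuleCat.of R (Via χ₀)) (n + 1)) ≤ C :=
    fun n => by
      obtain ⟨e⟩ := nonempty_ext_addEquiv (ModuleCat.of R (Via χ₀)) (ModuleCat.of R (Via χ₀)) n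
      rw [← abRank_congr e]
      exact H (n + 1) (by omega)
  have hup : ∀ n, b (n + 1) ≤ ((p ^ C * p ^ C : ℕ) : ℕ∞) := fun n => by
    have : AddGroup.FG (Abelian.Ext (ModuleCat.of R (Via χ₀)) (reduction χ₀ κ hκ₀).X₂ (n + 1)) :=
      hfg _
    have : AddGroup.FG (Abelian.Ext (ModuleCat.of R (Via χ₀)) (reduction χ₀ κ hκ₀).X₁ (n + 2)) :=
      hfg _
    refine (card_le_pow_abRank (reduction_shortExact χ₀ κ hκ₀ hp) hp (zsmul_id_eq_zero κ)
      (ModuleCat.of R (Via χ₀)) (n + 1)).trans ?_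
    rw [← Nat.cast_mul]
    exact Nat.cast_le.2 (Nat.mul_le_mul (Nat.pow_le_pow_right (Nat.pos_of_ne_zero hp) (hle n))
      (Nat.pow_le_pow_right (Nat.pos_of_ne_zero hp) (hle (n + 1))))
  have := (hpow (p ^ C * p ^ C)).trans (hup _)
  rw [Nat.cast_le] at this
  exact absurd this (not_le.2 Nat.lt_two_pow_self)

end

end Via

namespace burnsideRing

open MulAction

variable {G : Type} [Group G]

/-- The vector of marks of a `G`-set `X`. -/
def mark (G X : Type) [Group G] [MulAction G X] (K : Subgroup G) : ℤ :=
  (Nat.card (fixedPoints K X) : ℤ)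

lemma mark_mem (X : Type) [Finite X] [MulAction G X] : mark G X ∈ burnsideRing G :=
  Subring.subset_closure ⟨X, Fintype.ofFinite X, inferInstance, rfl⟩

lemma mark_map_conj (X : Type) [MulAction G X] (K : Subgroup G) (g : G) :
    mark G X (K.map (MulAut.conj g).toMonoidHom) = mark G X K := by
  refine congrArg Nat.cast (Nat.card_congr ((MulAction.toPerm g).subtypeEquiv fun x => ?_)).symm
  simp only [mem_fixedPoints, Subtype.forall, Subgroup.mk_smul, MulAction.toPerm_apply]
  constructor
  · rintro h _ ⟨k, hk, rfl⟩
    simp [MulAut.conj_apply, mul_smul, h k hk]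
  · intro h k hk
    have := h _ ⟨k, hk, rfl⟩
    simpa [MulAut.conj_apply, mul_smul] using this

lemma map_conj_of_mem {f : Subgroup G → ℤ} (hf : f ∈ burnsideRing G) (K : Subgroup G) (g : G) :
    f (K.map (MulAut.conj g).toMonoidHom) = f K := by
  induction hf using Subring.closure_induction with
  | mem f h =>
    obtain ⟨X, _, _, rfl⟩ := h
    exact mark_map_conj X K g
  | zero => rfl
  | one => rfl
  | add f f' _ _ h h' => rw [Pi.add_apply, Pi.add_apply, h, h']
  | neg f _ h => rw [Pi.neg_apply, Pi.neg_apply, h]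
  | mul f f' _ _ h h' => rw [Pi.mul_apply, Pi.mul_apply, h, h']

lemma zmod_cast_eq_of_isPGroup {p : ℕ} [Fact p.Prime] {f : Subgroup G → ℤ}
    (hf : f ∈ burnsideRing G) {K : Subgroup G} (hK : IsPGroup p K) :
    ((f K : ℤ) : ZMod p) = ((f ⊥ : ℤ) : ZMod p) := by
  induction hf using Subring.closure_induction with
  | mem f h =>
    obtain ⟨X, _, _, rfl⟩ := h
    rw [Int.cast_natCast, Int.cast_natCast, ZMod.natCast_eq_natCast_iff]
    refine (hK.card_modEq_card_fixedPoints X).symm.trans ?_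
    have h : fixedPoints (⊥ : Subgroup G) X = Set.univ :=
      Set.eq_univ_of_forall fun x k => by
        rw [Subsingleton.elim k 1, one_smul]
    rw [h, Nat.card_univ]
  | zero => rfl
  | one => rfl
  | add f f' _ _ h h' => simp only [Pi.add_apply, Int.cast_add, h, h']
  | neg f _ h => simp only [Pi.neg_apply, Int.cast_neg, h]
  | mul f f' _ _ h h' => simp only [Pi.mul_apply, Int.cast_mul, h, h']

/-- The congruences that cut out the Burnside ring inside the ghost ring. -/
def SatisfiesCongruences (f : Subgroup G → ℤ) : Prop :=
  ∀ K : Subgroup G, (Nat.card (Subgroup.normalizer (K : Set G)) : ℤ) ∣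
    ∑ᶠ g : Subgroup.normalizer (K : Set G), f (K ⊔ Subgroup.zpowers g.1)

lemma mark_satisfiesCongruences [Finite G] (X : Type) [Finite X] [MulAction G X] :
    SatisfiesCongruences (mark G X) := by
  classical
  intro K
  let N := Subgroup.normalizer (K : Set G)
  have : Fintype N := Fintype.ofFinite N
  let Y := fixedPoints (K.subgroupOf N) X
  have : ∀ g : N, Fintype (fixedBy Y g) := fun g => Fintype.ofFinite _
  have : Fintype (Quotient (orbitRel N Y)) := Fintype.ofFinite _
  have h := sum_card_fixedBy_eq_card_orbits_mul_card_group N Y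
  rw [finsum_eq_sum_of_fintype]
  refine ⟨Fintype.card (Quotient (orbitRel N Y)), ?_⟩
  rw [mul_comm, Nat.card_eq_fintype_card]
  refine Eq.trans ?_ ((congrArg (Nat.cast (R := ℤ)) h).trans (Nat.cast_mul _ _))
  rw [Nat.cast_sum]
  refine Finset.sum_congr rfl fun g _ => ?_
  rw [mark, ← Nat.card_eq_fintype_card]
  refine congrArg Nat.cast (Nat.card_congr ?_)
  have hY : ∀ x : X, x ∈ fixedPoints (K.subgroupOf N) X ↔ x ∈ fixedPoints K X := fun x => by
    constructor
    · intro hx k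
      exact hx ⟨⟨k.1, Subgroup.le_normalizer k.2⟩, k.2⟩
    · intro hx k
      exact hx ⟨k.1.1, k.2⟩
  have hg : ∀ x : X, x ∈ fixedPoints (Subgroup.zpowers g.1) X ↔ g • x = x := fun x => by
    constructor
    · intro hx
      exact hx ⟨g.1, Subgroup.mem_zpowers g.1⟩
    · intro hx k
      have : Subgroup.zpowers g.1 ≤ stabilizer G x := (Subgroup.zpowers_le).2 hx
      exact this k.2
  have hsup : ∀ x : X, x ∈ fixedPoints (↥(K ⊔ Subgroup.zpowers g.1)) X ↔
      x ∈ fixedPoints K X ∧ x ∈ fixedPoints (Subgroup.zpowers g.1) X := fun x => by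
    rw [fixedPoints_subgroup_sup]
    rfl
  exact
    { toFun := fun x => ⟨⟨x.1, (hY _).2 ((hsup _).1 x.2).1⟩,
        Subtype.ext ((hg _).1 ((hsup _).1 x.2).2)⟩
      invFun := fun y => ⟨y.1.1, (hsup _).2
        ⟨(hY _).1 y.1.2, (hg _).2 (congrArg Subtype.val y.2)⟩⟩
      left_inv := fun x => rfl
      right_inv := fun y => rfl }

lemma SatisfiesCongruences.sub_zsmul [Finite G] {f f' : Subgroup G → ℤ}
    (hf : SatisfiesCongruences f) (hf' : SatisfiesCongruences f') (m : ℤ) :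
    SatisfiesCongruences (f - m • f') := by
  intro K
  have : Fintype (Subgroup.normalizer (K : Set G)) := Fintype.ofFinite _
  have h := dvd_sub (hf K) ((hf' K).mul_left m)
  rw [finsum_eq_sum_of_fintype] at h ⊢
  rw [finsum_eq_sum_of_fintype, Finset.mul_sum, ← Finset.sum_sub_distrib] at h
  exact h

lemma card_mul_mark_quotient_self [Finite G] (K : Subgroup G) :
    (Nat.card K : ℤ) * mark G (G ⧸ K) K = Nat.card (Subgroup.normalizer (K : Set G)) := by
  have h := Subgroup.card_eq_card_quotient_mul_card_subgroup
    (K.subgroupOf (Subgroup.normalizer (K : Set G)))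
  rw [Nat.card_congr (Subgroup.subgroupOfEquivOfLe (Subgroup.le_normalizer (H := K))).toEquiv] at h
  rw [h, Nat.cast_mul, mul_comm]
  exact congrArg (fun n : ℕ => (n : ℤ) * Nat.card K)
    (Nat.card_congr (Sylow.fixedPointsMulLeftCosetsEquivQuotient K))

lemma exists_map_conj_le_of_mark_quotient_ne_zero {K L : Subgroup G}
    (h : mark G (G ⧸ K) L ≠ 0) : ∃ g : G, L.map (MulAut.conj g).toMonoidHom ≤ K := by
  rw [mark, Nat.cast_ne_zero] at h
  obtain ⟨x⟩ := (Nat.card_ne_zero.1 h).1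
  obtain ⟨g, hg⟩ := QuotientGroup.mk_surjective x.1
  refine ⟨g⁻¹, ?_⟩
  rintro _ ⟨k, hk, rfl⟩
  have := x.2 ⟨k, hk⟩
  rw [← hg, Subgroup.mk_smul, MulAction.Quotient.smul_mk, eq_comm, QuotientGroup.eq] at this
  simpa [MulAut.conj_apply, mul_assoc] using this

lemma card_map_conj (L : Subgroup G) (g : G) :
    Nat.card (L.map (MulAut.conj g).toMonoidHom) = Nat.card L :=
  (Nat.card_congr (L.equivMapOfInjective _ (MulAut.conj g).injective).toEquiv).symm

lemma SatisfiesCongruences.card_normalizer_dvd [Finite G] {f : Subgroup G → ℤ}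
    (hf : SatisfiesCongruences f) {K : Subgroup G}
    (hK : ∀ L : Subgroup G, Nat.card K < Nat.card L → f L = 0) :
    (Nat.card (Subgroup.normalizer (K : Set G)) : ℤ) ∣ Nat.card K * f K := by
  classical
  have : Fintype (Subgroup.normalizer (K : Set G)) := Fintype.ofFinite _
  have h := hf K
  rw [finsum_eq_sum_of_fintype, Finset.sum_congr rfl
    (g := fun g => if g ∈ K.subgroupOf (Subgroup.normalizer (K : Set G)) then f K else 0)
    fun g _ => ?_, ← Finset.sum_filter, Finset.sum_const, nsmul_eq_mul,
    ← Fintype.card_subtype, ← Nat.card_eq_fintype_card] at h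
  · rwa [← Nat.card_congr
      (Subgroup.subgroupOfEquivOfLe (Subgroup.le_normalizer (H := K))).toEquiv]
  · split_ifs with hg
    · rw [sup_eq_left.2 (Subgroup.zpowers_le.2 (Subgroup.mem_subgroupOf.1 hg))]
    · refine hK _ (lt_of_le_of_ne (Subgroup.card_le_of_le le_sup_left) fun hc => hg ?_)
      have := Subgroup.eq_of_le_of_card_ge
        (le_sup_left : K ≤ K ⊔ Subgroup.zpowers g.1) hc.ge
      exact Subgroup.mem_subgroupOf.2
        (this.ge (Subgroup.mem_sup_right (Subgroup.mem_zpowers g.1)))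

/-- Dress's congruences characterise the Burnside ring. -/
lemma mem_of_satisfiesCongruences [Finite G] {f : Subgroup G → ℤ}
    (hconj : ∀ (K : Subgroup G) (g : G), f (K.map (MulAut.conj g).toMonoidHom) = f K)
    (hf : SatisfiesCongruences f) : f ∈ burnsideRing G := by
  classical
  have : Fintype (Subgroup G) := Fintype.ofFinite _
  suffices h : ∀ n : ℕ, ∀ f : Subgroup G → ℤ,
      (∀ (K : Subgroup G) (g : G), f (K.map (MulAut.conj g).toMonoidHom) = f K) →
      SatisfiesCongruences f → (∀ L : Subgroup G, n ≤ Nat.card L → f L = 0) →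
      f ∈ burnsideRing G from
    h (Nat.card G + 1) f hconj hf fun L hL =>
      absurd (Subgroup.card_le_card_group L) (by omega)
  intro n
  induction n with
  | zero =>
    intro f _ _ h
    rw [show f = 0 from funext fun L => h L (Nat.zero_le _)]
    exact zero_mem _
  | succ n ih =>
    suffices h : ∀ m : ℕ, ∀ f : Subgroup G → ℤ,
        (∀ (K : Subgroup G) (g : G), f (K.map (MulAut.conj g).toMonoidHom) = f K) →
        SatisfiesCongruences f → (∀ L : Subgroup G, n + 1 ≤ Nat.card L → f L = 0) →
        (Finset.univ.filter fun L : Subgroup G => Nat.card L = n ∧ f L ≠ 0).card = m →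
        f ∈ burnsideRing G from
      fun f h₁ h₂ h₃ => h _ f h₁ h₂ h₃ rfl
    intro m
    induction m using Nat.strong_induction_on with
    | _ m ihm =>
    intro f hconj hf hn hm
    by_cases hK : ∃ K : Subgroup G, Nat.card K = n ∧ f K ≠ 0
    · obtain ⟨K, hKn, hK⟩ := hK
      obtain ⟨a, ha⟩ := hf.card_normalizer_dvd (K := K) fun L hL => hn L (by omega)
      rw [← card_mul_mark_quotient_self, mul_assoc] at ha
      have hfK : f K = mark G (G ⧸ K) K * a :=
        mul_left_cancel₀ (Nat.cast_ne_zero.2 Nat.card_pos.ne') ha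
      have hmark : ∀ L : Subgroup G, n ≤ Nat.card L → mark G (G ⧸ K) L ≠ 0 →
          ∃ g : G, L.map (MulAut.conj g).toMonoidHom = K := by
        intro L hL h
        obtain ⟨g, hg⟩ := exists_map_conj_le_of_mark_quotient_ne_zero h
        exact ⟨g, Subgroup.eq_of_le_of_card_ge hg (by rw [card_map_conj]; omega)⟩
      have key : f - a • mark G (G ⧸ K) ∈ burnsideRing G := by
        refine ihm _ ?_ _ ?_ (hf.sub_zsmul (mark_satisfiesCongruences _) a) ?_ rfl
        · rw [← hm]
          refine Finset.card_lt_card (Finset.ssubset_iff_of_subset ?_ |>.2 ⟨K, ?_, ?_⟩)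
          · intro L hL
            simp only [Finset.mem_filter, Finset.mem_univ, true_and] at hL ⊢
            refine ⟨hL.1, fun h0 => hL.2 ?_⟩
            by_contra hne
            rw [Pi.sub_apply, h0, Pi.smul_apply, smul_eq_mul, zero_sub, neg_eq_zero] at hne
            obtain ⟨g, rfl⟩ := hmark L hL.1.ge (right_ne_zero_of_mul hne)
            exact hK ((hconj L g).trans h0)
          · simp [hKn, hK]
          · simp [hfK, mul_comm]
        · intro L g
          rw [Pi.sub_apply, Pi.sub_apply, Pi.smul_apply, Pi.smul_apply, hconj, mark_map_conj]
        · intro L hL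
          rw [Pi.sub_apply, Pi.smul_apply, hn L hL, zero_sub, neg_eq_zero]
          by_contra hne
          obtain ⟨g, rfl⟩ := hmark L (by omega) (right_ne_zero_of_mul hne)
          rw [card_map_conj] at hKn
          omega
      rw [← sub_add_cancel f (a • mark G (G ⧸ K))]
      exact add_mem key (zsmul_mem (mark_mem _) a)
    · push Not at hK
      refine ih f hconj hf fun L hL => ?_
      rcases hL.eq_or_lt with h | h
      · exact hK L h.symm
      · exact hn L h

lemma card_dvd_mul_card_sup_zpowers_eq_top {P : Type} [Group P] [Finite P] (K : Subgroup P)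
    [K.Normal] {p n : ℕ} (hp : p.Prime) (hP : Nat.card P = p ^ n) :
    p ^ n ∣ p * Nat.card {x : P // K ⊔ Subgroup.zpowers x = ⊤} := by
  classical
  have : Fintype (P ⧸ K) := Fintype.ofFinite _
  let t : Set (P ⧸ K) := {q | orderOf q = Nat.card (P ⧸ K)}
  have ht : ∀ x : P, K ⊔ Subgroup.zpowers x = ⊤ ↔ (x : P ⧸ K) ∈ t := fun x => by
    rw [Set.mem_ofPred_eq, ← Nat.card_zpowers, Subgroup.card_eq_iff_eq_top,
      show (x : P ⧸ K) = QuotientGroup.mk' K x from rfl, ← MonoidHom.map_zpowers,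
      ← (Subgroup.comap_injective (QuotientGroup.mk'_surjective K)).eq_iff,
      Subgroup.comap_map_eq, Subgroup.comap_top, QuotientGroup.ker_mk', sup_comm]
  have hcard : Nat.card {x : P // K ⊔ Subgroup.zpowers x = ⊤} = Nat.card K * Nat.card t := by
    rw [← Nat.card_prod, ← Nat.card_congr (QuotientGroup.preimageMkEquivSubgroupProdSet K t)]
    exact Nat.card_congr (Equiv.subtypeEquivRight ht)
  rw [hcard]
  rcases t.eq_empty_or_nonempty with h | ⟨q, hq⟩
  · simp [h]
  have hcyc : IsCyclic (P ⧸ K) := isCyclic_of_orderOf_eq_card q hq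
  have htot : Nat.card t = (Nat.card (P ⧸ K)).totient := by
    rw [← IsCyclic.card_orderOf_eq_totient (α := P ⧸ K) (d := Nat.card (P ⧸ K))
      (by rw [Nat.card_eq_fintype_card]), ← Fintype.card_subtype, ← Nat.card_eq_fintype_card]
    rfl
  have hQ := Subgroup.card_eq_card_quotient_mul_card_subgroup K
  obtain ⟨i, -, hi⟩ := (Nat.dvd_prime_pow hp).1 (hP ▸ K.card_quotient_dvd_card)
  rw [htot, ← hP, hQ, mul_comm (Nat.card (P ⧸ K)), mul_left_comm]
  refine mul_dvd_mul_left _ ?_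
  rw [hi]
  rcases i with _ | i
  · simp
  · rw [Nat.totient_prime_pow_succ hp, ← mul_assoc, ← pow_succ']
    exact dvd_mul_right _ _

/-- The vector supported on the subgroups of order `m`, with constant value `v` there. -/
def orderVec (G : Type) [Group G] (m : ℕ) (v : ℤ) (K : Subgroup G) : ℤ :=
  open Classical in if Nat.card K = m then v else 0

lemma pow_dvd_mul_card_sup_zpowers [Finite G] {p n : ℕ} (hp : p.Prime) (K : Subgroup G) :
    p ^ n ∣ p * Nat.card {g : Subgroup.normalizer (K : Set G) //
      Nat.card ↥(K ⊔ Subgroup.zpowers g.1) = p ^ n} := by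
  classical
  have : Fintype (Subgroup G) := Fintype.ofFinite _
  let N := Subgroup.normalizer (K : Set G)
  have : Fintype N := Fintype.ofFinite _
  rw [Nat.card_eq_fintype_card, Fintype.card_subtype,
    Finset.card_eq_sum_card_fiberwise (f := fun g : N => K ⊔ Subgroup.zpowers g.1)
      (t := Finset.univ) (fun _ _ => Finset.mem_coe.2 (Finset.mem_univ _)), Finset.mul_sum]
  refine Finset.dvd_sum fun L _ => ?_
  rw [Finset.filter_filter]
  by_cases hL : ∃ g : N, Nat.card ↥(K ⊔ Subgroup.zpowers g.1) = p ^ n ∧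
    K ⊔ Subgroup.zpowers g.1 = L
  · obtain ⟨g, hg, rfl⟩ := hL
    set L := K ⊔ Subgroup.zpowers g.1 with hLdef
    have hKL : K ≤ L := le_sup_left
    have hLN : L ≤ N := sup_le Subgroup.le_normalizer (Subgroup.zpowers_le.2 g.2)
    have : (K.subgroupOf L).Normal :=
      (Subgroup.normal_subgroupOf_iff_le_normalizer hKL).2 hLN
    have key := card_dvd_mul_card_sup_zpowers_eq_top (K.subgroupOf L) hp hg
    rw [← Fintype.card_subtype, ← Nat.card_eq_fintype_card]
    have hiff : ∀ x : L, K.subgroupOf L ⊔ Subgroup.zpowers x = ⊤ ↔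
        K ⊔ Subgroup.zpowers x.1 = L := fun x => by
      rw [← (Subgroup.map_injective L.subtype_injective).eq_iff, Subgroup.map_sup,
        Subgroup.map_subgroupOf_eq_of_le hKL, MonoidHom.map_zpowers, ← MonoidHom.range_eq_map,
        Subgroup.range_subtype]
      rfl
    let e : {g : N // Nat.card ↥(K ⊔ Subgroup.zpowers g.1) = p ^ n ∧
        K ⊔ Subgroup.zpowers g.1 = L} ≃
        {x : L // K.subgroupOf L ⊔ Subgroup.zpowers x = ⊤} :=
      { toFun := fun y => ⟨⟨y.1.1, y.2.2.le
          (Subgroup.mem_sup_right (Subgroup.mem_zpowers _))⟩, (hiff _).2 y.2.2⟩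
        invFun := fun x => ⟨⟨x.1.1, hLN x.1.2⟩, by
          have := (hiff _).1 x.2
          exact ⟨(congrArg (fun M : Subgroup G => Nat.card M) this).trans hg, this⟩⟩
        left_inv := fun y => rfl
        right_inv := fun x => rfl }
    exact key.trans (mul_dvd_mul_left p (Nat.card_congr e).symm.dvd)
  · rw [Finset.filter_false_of_mem fun g _ h => hL ⟨g, h⟩]
    simp

lemma orderVec_mem [Finite G] {p n c : ℕ} (hp : p.Prime) (hG : Nat.card G = p ^ n * c) :
    orderVec G (p ^ n) (p * c) ∈ burnsideRing G := by
  classical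
  refine mem_of_satisfiesCongruences (fun K g => ?_) fun K => ?_
  · rw [orderVec, orderVec, card_map_conj]
  have : Fintype (Subgroup.normalizer (K : Set G)) := Fintype.ofFinite _
  rw [finsum_eq_sum_of_fintype]
  simp only [orderVec]
  rw [← Finset.sum_filter, Finset.sum_const, nsmul_eq_mul, ← Fintype.card_subtype,
    ← Nat.card_eq_fintype_card]
  norm_cast
  by_cases hT : ∃ g : Subgroup.normalizer (K : Set G),
      Nat.card ↥(K ⊔ Subgroup.zpowers g.1) = p ^ n
  · obtain ⟨g, hg⟩ := hT
    have hLN : K ⊔ Subgroup.zpowers g.1 ≤ Subgroup.normalizer (K : Set G) :=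
      sup_le Subgroup.le_normalizer (Subgroup.zpowers_le.2 g.2)
    obtain ⟨c', hc'⟩ := hg ▸ Subgroup.card_dvd_of_le hLN
    have hcc : c' ∣ c := by
      have := Subgroup.card_subgroup_dvd_card (Subgroup.normalizer (K : Set G))
      rw [hc', hG] at this
      exact Nat.dvd_of_mul_dvd_mul_left (pow_pos hp.pos n) this
    rw [hc', mul_left_comm, ← mul_assoc]
    exact mul_dvd_mul (pow_dvd_mul_card_sup_zpowers hp K) hcc
  · have : IsEmpty {g : Subgroup.normalizer (K : Set G) //
      Nat.card ↥(K ⊔ Subgroup.zpowers g.1) = p ^ n} := ⟨fun g => hT ⟨g.1, g.2⟩⟩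
    refine Dvd.intro_left 0 ?_
    rw [zero_mul, eq_comm]
    exact mul_eq_zero_of_left Nat.card_of_isEmpty _

/-- Elements of the Burnside ring are constant on the Sylow subgroups for a fixed prime. -/
lemma apply_eq_of_card_eq [Finite G] {p : ℕ} [Fact p.Prime] {f : Subgroup G → ℤ}
    (hf : f ∈ burnsideRing G) {K L : Subgroup G}
    (hK : Nat.card K = p ^ (Nat.card G).factorization p)
    (hL : Nat.card L = p ^ (Nat.card G).factorization p) : f K = f L := by
  obtain ⟨g, hg⟩ := MulAction.exists_smul_eq G (Sylow.ofCard K hK) (Sylow.ofCard L hL)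
  rw [← map_conj_of_mem hf K g]
  exact congrArg f (congrArg Sylow.toSubgroup hg)

instance [Finite G] : Module.Finite ℤ (burnsideRing G) :=
  have : Fintype (Subgroup G) := Fintype.ofFinite _
  Module.Finite.of_injective ((burnsideRing G).subtype.toAddMonoidHom.toIntLinearMap)
    Subtype.val_injective

instance [Finite G] : IsNoetherianRing (burnsideRing G) :=
  IsNoetherianRing.of_finite ℤ _

/-- The mark homomorphism at `K`. -/
def markHom (K : Subgroup G) : burnsideRing G →+* ℤ :=
  (Pi.evalRingHom (fun _ => ℤ) K).comp (burnsideRing G).subtype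

lemma mark_regular_eq_zero [Finite G] {K : Subgroup G} (hK : K ≠ ⊥) : mark G G K = 0 := by
  obtain ⟨k, hk, hk1⟩ := (Subgroup.ne_bot_iff_exists_ne_one.1 hK).elim
    fun a ha => (⟨a.1, a.2, fun h => ha (Subtype.ext h)⟩ : ∃ k ∈ K, k ≠ 1)
  have : IsEmpty (fixedPoints K G) := ⟨fun x => hk1 (mul_eq_right.1 (x.2 ⟨k, hk⟩))⟩
  rw [mark, Nat.card_of_isEmpty, Nat.cast_zero]

lemma mark_regular_bot : mark G G ⊥ = Nat.card G := by
  have h : fixedPoints (⊥ : Subgroup G) G = Set.univ :=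
    Set.eq_univ_of_forall fun x k => by
      rw [Subsingleton.elim k 1, one_smul]
  rw [mark, h, Nat.card_univ]

lemma mark_quotient_self_ne_zero [Finite G] (K : Subgroup G) : mark G (G ⧸ K) K ≠ 0 :=
  right_ne_zero_of_mul ((card_mul_mark_quotient_self K).trans_ne
    (Nat.cast_ne_zero.2 Nat.card_pos.ne'))

end burnsideRing

/-- Let `G` be a finite group whose order is not square-free.  Then there exist subgroups
`H, J ≤ G` such that the sequence of ranks of the finite abelian groups
`Ext^l_{A(G)}(ℤ_H, ℤ_J)`, `l ≥ 1`, is unbounded. -/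
theorem stmt_18 (G : Type) [Group G] [Finite G] (hG : ¬ Squarefree (Nat.card G)) :
    ∃ H J : Subgroup G, ∀ C : ℕ, ∃ l : ℕ, 1 ≤ l ∧
      C < abRank
        (((Ext (burnsideRing G) (ModuleCat (burnsideRing G)) l).obj
          (Opposite.op (ZB G H))).obj (ZB G J)) := by
  obtain ⟨p, hp, hpG⟩ : ∃ p : ℕ, p.Prime ∧ p * p ∣ Nat.card G := by
    by_contra! h
    exact hG (Nat.squarefree_iff_prime_squarefree.2 h)
  have : Fact p.Prime := ⟨hp⟩
  obtain ⟨S, hS⟩ : ∃ S : Subgroup G, Nat.card S = p ^ (Nat.card G).factorization p :=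
    Sylow.exists_subgroup_card_pow_prime p (Nat.ordProj_dvd _ _)
  obtain ⟨E, hE⟩ : ∃ E : Subgroup G, Nat.card E = p ^ 1 :=
    Sylow.exists_subgroup_card_pow_prime p (by rw [pow_one]; exact dvd_of_mul_left_dvd hpG)
  have hn : 2 ≤ (Nat.card G).factorization p :=
    (hp.pow_dvd_iff_le_factorization Nat.card_pos.ne').1 (by rwa [pow_two])
  have hE1 : E ≠ ⊥ := fun h => hp.one_lt.ne' (by
    rw [h, Subgroup.card_bot, pow_one] at hE
    exact hE.symm)
  have hc := (Nat.ordProj_mul_ordCompl_eq_self (Nat.card G) p).symm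
  set n := (Nat.card G).factorization p with hndef
  set c := Nat.card G / p ^ n with hcdef
  have hES : burnsideRing.mark G (G ⧸ E) S = 0 := by
    by_contra h
    obtain ⟨g, hg⟩ := burnsideRing.exists_map_conj_le_of_mark_quotient_ne_zero h
    have := Subgroup.card_le_of_le hg
    rw [burnsideRing.card_map_conj, hS, hE] at this
    have := (Nat.pow_le_pow_iff_right hp.one_lt).1 this
    omega
  have hcast {K : Subgroup G} {m : ℕ} (hK : Nat.card K = p ^ m) (a : burnsideRing G) :
      ((burnsideRing.markHom K a : ℤ) : ZMod p) =
        ((Int.castRingHom (ZMod p)).comp (burnsideRing.markHom ⊥)) a :=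
    burnsideRing.zmod_cast_eq_of_isPGroup a.2 (IsPGroup.of_card hK)
  let w : burnsideRing G := ⟨burnsideRing.mark G (G ⧸ E), burnsideRing.mark_mem _⟩ *
    (⟨burnsideRing.mark G G, burnsideRing.mark_mem _⟩ - (Nat.card G : burnsideRing G))
  have hw (K : Subgroup G) : burnsideRing.markHom K w =
      burnsideRing.mark G (G ⧸ E) K * (burnsideRing.mark G G K - Nat.card G) := by
    rw [map_mul, map_sub, map_natCast]
    rfl
  refine ⟨⊥, ⊥, fun C => ?_⟩
  refine Via.exists_lt_abRank_ext (burnsideRing.markHom ⊥) (burnsideRing.markHom S)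
    (burnsideRing.markHom E) ((Int.castRingHom (ZMod p)).comp (burnsideRing.markHom ⊥))
    (fun _ => rfl) (hcast hS) (hcast hE) (c := c) ?_
    (s := ⟨burnsideRing.orderVec G (p ^ n) (p * c), burnsideRing.orderVec_mem hp hc⟩)
    (fun a => Subtype.ext (funext fun L => ?_)) ?_ ?_ (w := w) ?_ ?_ ?_ C
  · exact_mod_cast Nat.not_dvd_ordCompl hp Nat.card_pos.ne'
  · change a.1 L * burnsideRing.orderVec G (p ^ n) (p * c) L =
      ((a.1 S : ℤ) : burnsideRing G).1 L * burnsideRing.orderVec G (p ^ n) (p * c) L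
    rw [burnsideRing.orderVec]
    split_ifs with hL
    · rw [burnsideRing.apply_eq_of_card_eq a.2 hL hS]
      rfl
    · rw [mul_zero, mul_zero]
  · exact if_neg (by
      rw [Subgroup.card_bot, eq_comm]
      exact (Nat.one_lt_pow (by omega) hp.one_lt).ne')
  · exact if_pos hS
  · rw [hw, burnsideRing.mark_regular_bot, sub_self, mul_zero]
  · rw [hw, hES, zero_mul]
  · rw [hw, burnsideRing.mark_regular_eq_zero hE1, zero_sub]
    exact mul_ne_zero (burnsideRing.mark_quotient_self_ne_zero E)
      (neg_ne_zero.2 (Nat.cast_ne_zero.2 Nat.card_pos.ne'))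
end
end
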